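/- arXiv:1904.03599 — 2 statements merged into one kernel-verified Lean document; each statement's English description precedes it below -/
import Mathlib

section
/- Let Γ be a simplicial graph and 𝒢 = (G_u) a family of nontrivial groups indexed by the vertices of Γ. If Γ is not complete (there exist two distinct non-adjacent vertices), then there exist a group Q, a surjective group homomorphism PConjAut(Γ𝒢) → Q, a simple graph T which is a tree (connected and acyclic), and an action of Q on T by graph automorphisms such that no vertex of T is fixed by every element of Q. -/
/-- The set of commutation relators defining a graph product. -/
def graphProdRels {V : Type*} (Γ : SimpleGraph V) (G : V → Type*) [∀ w, Group (G w)] :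
    Set (Monoid.CoprodI G) :=
  {x | ∃ (u v : V) (_ : Γ.Adj u v) (g : G u) (h : G v),
    x = Monoid.CoprodI.of g * Monoid.CoprodI.of h *
      (Monoid.CoprodI.of g)⁻¹ * (Monoid.CoprodI.of h)⁻¹}

/-- The graph product of the family of groups `G` over the simplicial graph `Γ`. -/
def GraphProduct {V : Type*} (Γ : SimpleGraph V) (G : V → Type*) [∀ w, Group (G w)] :=
  Monoid.CoprodI G ⧸ Subgroup.normalClosure (graphProdRels Γ G)

instance {V : Type*} (Γ : SimpleGraph V) (G : V → Type*) [∀ w, Group (G w)] :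
    Group (GraphProduct Γ G) :=
  inferInstanceAs (Group (Monoid.CoprodI G ⧸ Subgroup.normalClosure (graphProdRels Γ G)))

/-- The canonical map from a vertex group into the graph product. -/
def GraphProduct.of {V : Type*} (Γ : SimpleGraph V) (G : V → Type*) [∀ w, Group (G w)]
    (u : V) : G u →* GraphProduct Γ G :=
  (QuotientGroup.mk' (Subgroup.normalClosure (graphProdRels Γ G))).comp Monoid.CoprodI.of

/-- The vertex subgroup of the graph product at the vertex `u`. -/
def vertexSubgroup {V : Type*} (Γ : SimpleGraph V) (G : V → Type*) [∀ w, Group (G w)]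
    (u : V) : Subgroup (GraphProduct Γ G) :=
  (GraphProduct.of Γ G u).range

/-- An automorphism of the graph product is conjugating if it sends each vertex subgroup to
a conjugate of a vertex subgroup. -/
def IsConjugating {V : Type*} (Γ : SimpleGraph V) (G : V → Type*) [∀ w, Group (G w)]
    (φ : MulAut (GraphProduct Γ G)) : Prop :=
  ∀ u : V, ∃ (v : V) (g : GraphProduct Γ G),
    Subgroup.map φ.toMonoidHom (vertexSubgroup Γ G u) =
      Subgroup.map (MulAut.conj g).toMonoidHom (vertexSubgroup Γ G v)

/-- An automorphism of the graph product is in `PConjAut` if it sends each vertex subgroup to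
a conjugate of itself. -/
def IsPConjugating {V : Type*} (Γ : SimpleGraph V) (G : V → Type*) [∀ w, Group (G w)]
    (φ : MulAut (GraphProduct Γ G)) : Prop :=
  ∀ u : V, ∃ g : GraphProduct Γ G,
    Subgroup.map φ.toMonoidHom (vertexSubgroup Γ G u) =
      Subgroup.map (MulAut.conj g).toMonoidHom (vertexSubgroup Γ G u)

/-- A vertex is universal if it is adjacent to every other vertex. -/
def IsUniversal {V : Type*} (Γ : SimpleGraph V) (u : V) : Prop :=
  ∀ v : V, v ≠ u → Γ.Adj u v

/-- Some vertex is non-adjacent to at least two other vertices. -/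
def HasVertexWithTwoNonNeighbors {V : Type*} (Γ : SimpleGraph V) : Prop :=
  ∃ u v w : V, v ≠ w ∧ v ≠ u ∧ w ≠ u ∧ ¬Γ.Adj u v ∧ ¬Γ.Adj u w

/-- A group `G` is SQ-universal if every countable group embeds into a quotient of `G`. -/
def SQUniversal (G : Type*) [Group G] : Prop :=
  ∀ (Q : Type) [Group Q] [Countable Q],
    ∃ (N : Subgroup G) (hN : N.Normal),
      haveI := hN
      ∃ f : Q →* G ⧸ N, Function.Injective f

/-- A quasimorphism on a group. -/
def IsQuasimorphism {H : Type*} [Group H] (f : H → ℝ) : Prop :=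
  ∃ C : ℝ, 0 ≤ C ∧ ∀ g h : H, |f (g * h) - f g - f h| ≤ C

/-- A homogeneous map on a group. -/
def IsHomogeneous {H : Type*} [Group H] (f : H → ℝ) : Prop :=
  ∀ (g : H) (k : ℤ), f (g ^ k) = (k : ℝ) * f g

/-- The space of homogeneous quasimorphisms of `H` is infinite-dimensional, expressed as: it is
not contained in the span of any finite set of functions. -/
def HasManyQuasimorphisms (H : Type*) [Group H] : Prop :=
  ¬ ∃ s : Finset (H → ℝ), ∀ f : H → ℝ, IsQuasimorphism f → IsHomogeneous f →
      f ∈ Submodule.span ℝ (s : Set (H → ℝ))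

/-- A group virtually has many quasimorphisms if some finite-index subgroup has an
infinite-dimensional space of homogeneous quasimorphisms. -/
def VirtuallyManyQuasimorphisms (G : Type*) [Group G] : Prop :=
  ∃ H : Subgroup G, H.FiniteIndex ∧ HasManyQuasimorphisms H

/-- A group is boundedly generated if it is the product of finitely many cyclic subgroups. -/
def BoundedlyGenerated (G : Type*) [Group G] : Prop :=
  ∃ l : List G, ∀ g : G, ∃ m : List ℤ, m.length = l.length ∧
    g = (List.zipWith (fun x (k : ℤ) => x ^ k) l m).prod

/-- A group is large if a finite-index subgroup surjects onto a nonabelian free group. -/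
def IsLarge (G : Type*) [Group G] : Prop :=
  ∃ H : Subgroup G, H.FiniteIndex ∧ ∃ f : H →* FreeGroup (Fin 2), Function.Surjective f

/-- A group is virtually free abelian if it has a finite-index subgroup isomorphic to `ℤⁿ`. -/
def VirtuallyFreeAbelian (G : Type*) [Group G] : Prop :=
  ∃ H : Subgroup G, H.FiniteIndex ∧ ∃ n : ℕ, Nonempty (H ≃* Multiplicative (Fin n → ℤ))

/-- The relators of a right-angled Coxeter group. -/
def racgRels {V : Type*} (Γ : SimpleGraph V) : Set (FreeGroup V) :=
  {w | (∃ v : V, w = FreeGroup.of v * FreeGroup.of v) ∨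
    ∃ u v : V, Γ.Adj u v ∧ w = (FreeGroup.of u * FreeGroup.of v) ^ 2}

/-- The right-angled Coxeter group of a simplicial graph. -/
def RACG {V : Type*} (Γ : SimpleGraph V) := PresentedGroup (racgRels Γ)

instance {V : Type*} (Γ : SimpleGraph V) : Group (RACG Γ) :=
  inferInstanceAs (Group (PresentedGroup (racgRels Γ)))

open scoped Pointwise

/-- A graph with a rank function and a rank-decreasing parent map, all of whose edges join a vertex
to its parent and which has a unique vertex of rank zero, is a tree. -/
theorem SimpleGraph.isTree_of_parent {T : Type*} (G : SimpleGraph T) (root : T) (par : T → T)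
    (rk : T → ℕ) (hroot : ∀ x, rk x = 0 → x = root)
    (hpar : ∀ x, rk x ≠ 0 → G.Adj x (par x) ∧ rk (par x) < rk x)
    (hadj : ∀ x y, G.Adj x y → (rk x ≠ 0 ∧ par x = y) ∨ (rk y ≠ 0 ∧ par y = x)) :
    G.IsTree := by
  have hreach : ∀ n x, rk x = n → G.Reachable x root := by
    intro n
    induction n using Nat.strong_induction_on with
    | _ n ih =>
      intro x hx
      by_cases h0 : rk x = 0
      · rw [hroot x h0]
      · obtain ⟨h1, h2⟩ := hpar x h0
        exact h1.reachable.trans (ih _ (hx ▸ h2) _ rfl)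
  have hbridge : ∀ x, rk x ≠ 0 → ¬ (G.deleteEdges {s(x, par x)}).Reachable x (par x) := by
    intro x hx hr
    let Desc : T → Prop :=
      fun y => Relation.ReflTransGen (fun a b => rk a ≠ 0 ∧ par a = b) y x
    have hstep : ∀ y z, Desc y → (G.deleteEdges {s(x, par x)}).Adj y z → Desc z := by
      intro y z hy hyz
      rw [SimpleGraph.deleteEdges_adj] at hyz
      rcases hadj y z hyz.1 with ⟨_, h⟩ | h
      · rcases hy.cases_head with rfl | ⟨c, ⟨_, rfl⟩, hc⟩
        · subst h
          exact absurd rfl hyz.2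
        · exact h ▸ hc
      · exact hy.head h
    have hwalk : ∀ u v, (G.deleteEdges {s(x, par x)}).Walk u v → Desc u → Desc v := by
      intro u v p
      induction p with
      | nil => exact id
      | cons h _ ih => exact fun hu => ih (hstep _ _ hu h)
    have hle : ∀ y, Desc y → rk x ≤ rk y := by
      intro y hy
      induction hy using Relation.ReflTransGen.head_induction_on with
      | refl => exact le_rfl
      | head h _ ih => exact ih.trans (h.2 ▸ (hpar _ h.1).2.le)
    obtain ⟨p⟩ := hr
    exact absurd (hle _ (hwalk _ _ p .refl)) (not_le.mpr (hpar x hx).2)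
  have : Nonempty T := ⟨root⟩
  refine (SimpleGraph.isTree_iff G).mpr ⟨⟨fun x y => ?_⟩, ?_⟩
  · exact (hreach _ x rfl).trans (hreach _ y rfl).symm
  · rw [SimpleGraph.isAcyclic_iff_forall_adj_isBridge]
    intro x y hxy
    rw [SimpleGraph.isBridge_iff]
    rcases hadj x y hxy with ⟨h0, rfl⟩ | ⟨h0, rfl⟩
    · exact hbridge x h0
    · rw [Sym2.eq_swap]
      exact fun h => hbridge y h0 h.symm

namespace Monoid.CoprodI

section ReducedList

variable {ι : Type*} {M : ι → Type*} [∀ i, Group (M i)]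

/-- The list of syllables `l` is reduced: no syllable is trivial and adjacent syllables come from
different factors. -/
def IsReducedList (l : List (Σ i, M i)) : Prop :=
  (∀ x ∈ l, x.2 ≠ 1) ∧ l.IsChain fun x y => x.1 ≠ y.1

/-- The element of the free product represented by a list of syllables. -/
def listProd (l : List (Σ i, M i)) : CoprodI M :=
  (l.map fun x => of x.2).prod

/-- The formal inverse of a list of syllables. -/
def listInv (l : List (Σ i, M i)) : List (Σ i, M i) :=
  (l.map fun x => ⟨x.1, x.2⁻¹⟩).reverse

@[simp]
theorem listProd_nil : listProd ([] : List (Σ i, M i)) = 1 := rfl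

@[simp]
theorem listProd_cons (x : Σ i, M i) (l : List (Σ i, M i)) :
    listProd (x :: l) = of x.2 * listProd l := by
  simp [listProd]

@[simp]
theorem listProd_append (l l' : List (Σ i, M i)) :
    listProd (l ++ l') = listProd l * listProd l' := by
  simp [listProd]

@[simp]
theorem listProd_listInv (l : List (Σ i, M i)) : listProd (listInv l) = (listProd l)⁻¹ := by
  induction l with
  | nil => simp [listInv]
  | cons x l ih =>
    have : listInv (x :: l) = listInv l ++ [⟨x.1, x.2⁻¹⟩] := by simp [listInv]
    simp [this, ih]

theorem listProd_flatMap {N : ι → Type*} [∀ i, Group (N i)] (f : CoprodI M →* CoprodI N)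
    (F : (Σ i, M i) → List (Σ i, N i)) (hF : ∀ x, listProd (F x) = f (of x.2))
    (l : List (Σ i, M i)) : listProd (l.flatMap F) = f (listProd l) := by
  induction l with
  | nil => simp
  | cons x l ih => simp [ih, hF]

theorem IsReducedList.tail {x : Σ i, M i} {l : List (Σ i, M i)} (h : IsReducedList (x :: l)) :
    IsReducedList l :=
  ⟨fun y hy => h.1 y (List.mem_cons_of_mem _ hy), h.2.tail⟩

theorem isReducedList_append {l l' : List (Σ i, M i)} :
    IsReducedList (l ++ l') ↔ IsReducedList l ∧ IsReducedList l' ∧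
      ∀ x ∈ l.getLast?, ∀ y ∈ l'.head?, x.1 ≠ y.1 := by
  simp only [IsReducedList, List.isChain_append, List.mem_append]
  grind

theorem isReducedList_listInv {l : List (Σ i, M i)} (h : IsReducedList l) :
    IsReducedList (listInv l) := by
  refine ⟨?_, ?_⟩
  · simp only [listInv, List.mem_reverse, List.mem_map]
    rintro _ ⟨y, hy, rfl⟩
    exact inv_ne_one.mpr (h.1 y hy)
  · rw [listInv, List.isChain_reverse, List.isChain_map]
    exact h.2.imp fun _ _ hxy => hxy.symm

theorem isReducedList_singleton {i : ι} {a : M i} (ha : a ≠ 1) :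
    IsReducedList [(⟨i, a⟩ : Σ i, M i)] := by
  simpa [IsReducedList] using ha

theorem isReducedList_cons {l : List (Σ i, M i)} {i : ι} {a : M i} (h : IsReducedList l)
    (hi : ∀ x ∈ l.head?, x.1 ≠ i) (ha : a ≠ 1) : IsReducedList (⟨i, a⟩ :: l) := by
  rw [← List.singleton_append, isReducedList_append]
  refine ⟨isReducedList_singleton ha, h, ?_⟩
  simpa using fun x hx => (hi x hx).symm

theorem isReducedList_conj {l : List (Σ i, M i)} {i : ι} {a : M i} (h : IsReducedList l)
    (hi : ∀ x ∈ l.head?, x.1 ≠ i) (ha : a ≠ 1) :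
    IsReducedList (listInv l ++ ⟨i, a⟩ :: l) := by
  refine isReducedList_append.mpr
    ⟨isReducedList_listInv h, isReducedList_cons h hi ha, ?_⟩
  rintro x hx y hy
  rw [Option.mem_def, List.head?_cons, Option.some_inj] at hy
  subst hy
  rw [listInv, List.getLast?_reverse, List.head?_map] at hx
  obtain ⟨y, hy, rfl⟩ := Option.mem_map.mp hx
  exact hi y hy

theorem exists_listProd_eq (h : CoprodI M) :
    ∃ l : List (Σ i, M i), IsReducedList l ∧ listProd l = h := by
  classical
  exact ⟨(Word.equiv h).toList, ⟨(Word.equiv h).ne_one, (Word.equiv h).chain_ne⟩,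
    Word.equiv.symm_apply_apply h⟩

theorem listProd_injective {l l' : List (Σ i, M i)} (h : IsReducedList l) (h' : IsReducedList l')
    (e : listProd l = listProd l') : l = l' := by
  classical
  have : (⟨l, h.1, h.2⟩ : Word M) = ⟨l', h'.1, h'.2⟩ := Word.equiv.symm.injective e
  exact congrArg Word.toList this

/-- The conjugate `h⁻¹ * M i * h` of a factor of the free product. -/
def factorConj (i : ι) (h : CoprodI M) : Subgroup (CoprodI M) :=
  MulAut.conj h⁻¹ • (of : M i →* CoprodI M).range

theorem mem_factorConj {i : ι} {h x : CoprodI M} :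
    x ∈ factorConj i h ↔ ∃ a : M i, x = h⁻¹ * of a * h := by
  simp only [factorConj, Subgroup.mem_smul_pointwise_iff_exists, MonoidHom.mem_range]
  constructor
  · rintro ⟨_, ⟨a, rfl⟩, rfl⟩
    exact ⟨a, by simp [MulAut.smul_def]⟩
  · rintro ⟨a, rfl⟩
    exact ⟨_, ⟨a, rfl⟩, by simp [MulAut.smul_def]⟩

theorem conj_smul_factorConj (i : ι) (g h : CoprodI M) :
    MulAut.conj g⁻¹ • factorConj i h = factorConj i (h * g) := by
  rw [factorConj, factorConj, smul_smul, ← map_mul, mul_inv_rev]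

theorem factorConj_of_mul {i : ι} (a : M i) (h : CoprodI M) :
    factorConj i (of a * h) = factorConj i h := by
  have : factorConj i (of a) = factorConj i (1 : CoprodI M) := by
    simp only [factorConj, inv_one, map_one, one_smul, ← map_inv]
    exact Subgroup.conj_smul_eq_self_of_mem ⟨a⁻¹, rfl⟩
  rw [← conj_smul_factorConj, this, conj_smul_factorConj, one_mul]

theorem factorConj_sup_eq_top_mul_right {i j : ι} {x y : CoprodI M} (g : CoprodI M) :
    factorConj i (x * g) ⊔ factorConj j (y * g) = ⊤ ↔ factorConj i x ⊔ factorConj j y = ⊤ := by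
  rw [← conj_smul_factorConj, ← conj_smul_factorConj, ← Subgroup.smul_sup]
  constructor
  · intro h
    rw [eq_top_iff] at h ⊢
    intro z _
    exact Subgroup.smul_mem_pointwise_smul_iff.mp (h (Subgroup.mem_top (MulAut.conj g⁻¹ • z)))
  · intro h
    rw [h, eq_top_iff]
    intro z _
    rw [Subgroup.mem_pointwise_smul_iff_inv_smul_mem]
    exact Subgroup.mem_top _

theorem factorConj_listProd_injective [∀ i, Nontrivial (M i)] {i : ι} {l l' : List (Σ i, M i)}
    (h : IsReducedList l) (h' : IsReducedList l') (hi : ∀ x ∈ l.head?, x.1 ≠ i)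
    (hi' : ∀ x ∈ l'.head?, x.1 ≠ i)
    (e : factorConj i (listProd l) = factorConj i (listProd l')) : l = l' := by
  obtain ⟨a, ha⟩ := exists_ne (1 : M i)
  have hmem : (listProd l)⁻¹ * of a * listProd l ∈ factorConj i (listProd l') :=
    e ▸ mem_factorConj.mpr ⟨a, rfl⟩
  obtain ⟨b, hb⟩ := mem_factorConj.mp hmem
  have hb1 : b ≠ 1 := by
    rintro rfl
    apply ha
    apply of_injective i
    rw [map_one, mul_one, inv_mul_cancel, mul_assoc, inv_mul_eq_one] at hb
    rw [map_one]
    exact right_eq_mul.mp hb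
  have hl := listProd_injective (isReducedList_conj h hi ha) (isReducedList_conj h' hi' hb1)
    (by simpa [mul_assoc] using hb)
  have hlen := congrArg List.length hl
  simp only [List.length_append, listInv, List.length_reverse, List.length_map,
    List.length_cons] at hlen
  have := (List.append_inj hl (by
    simp only [listInv, List.length_reverse, List.length_map]
    omega)).2
  exact (List.cons.inj this).2

end ReducedList

section Bool

variable {M : Bool → Type*} [∀ i, Group (M i)]

theorem factorConj_sup_factorConj_self (i : Bool) (h : CoprodI M) :
    factorConj i h ⊔ factorConj (!i) h = ⊤ := by
  rw [← one_mul h, factorConj_sup_eq_top_mul_right, eq_top_iff]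
  rintro x -
  induction x using CoprodI.induction_on with
  | one => exact one_mem _
  | of j a =>
    by_cases hj : j = i
    · subst hj
      exact Subgroup.mem_sup_left (mem_factorConj.mpr ⟨a, by simp⟩)
    · obtain rfl : j = !i := by cases i <;> cases j <;> simp_all
      exact Subgroup.mem_sup_right (mem_factorConj.mpr ⟨a, by simp⟩)
  | mul x y hx hy => exact mul_mem hx hy

theorem factorConj_sup_ne_top [∀ i, Nontrivial (M i)] {j : Bool} {l : List (Σ i, M i)}
    (hl : IsReducedList l) (hne : l ≠ []) (hhead : ∀ x ∈ l.head?, x.1 ≠ j)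
    (hlast : ∀ x ∈ l.getLast?, x.1 = j) :
    factorConj (!j) 1 ⊔ factorConj j (listProd l) ≠ ⊤ := by
  intro htop
  obtain ⟨b, hb⟩ := exists_ne (1 : M j)
  let f : CoprodI M →* CoprodI M := lift fun k =>
    if k = j then (MulAut.conj (listProd l)⁻¹).toMonoidHom.comp of else of
  let F : (Σ i, M i) → List (Σ i, M i) := fun x =>
    if x.1 = j then listInv l ++ x :: l else [x]
  have hF : ∀ x, listProd (F x) = f (of x.2) := by
    intro x
    by_cases hx : x.1 = j
    · simp [F, f, hx, mul_assoc]
    · simp [F, f, hx]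
  have hsurj : f.range = ⊤ := by
    rw [eq_top_iff, ← htop, sup_le_iff]
    constructor
    · intro x hx
      obtain ⟨a, rfl⟩ := mem_factorConj.mp hx
      exact ⟨of a, by simp [f]⟩
    · intro x hx
      obtain ⟨a, rfl⟩ := mem_factorConj.mp hx
      exact ⟨of a, by simp [f]⟩
  have hred : ∀ x : Σ i, M i, x.2 ≠ 1 → IsReducedList (F x) := by
    rintro ⟨k, a⟩ hx
    by_cases hk : k = j
    · subst hk
      simpa [F] using isReducedList_conj hl hhead hx
    · simpa [F, hk] using isReducedList_singleton hx
  have hz := List.getLast?_eq_some_getLast hne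
  have hFhead : ∀ x, ∀ y ∈ (F x).head?, y.1 = x.1 := by
    intro x y hy
    by_cases hk : x.1 = j
    · simp only [F, hk, if_true, List.head?_append, listInv, List.head?_reverse,
        List.getLast?_map] at hy
      rw [hz] at hy
      have := hlast _ hz
      simp only [Option.map_some, Option.some_or, Option.mem_def, Option.some_inj] at hy
      rw [← hy, hk, this]
    · simp only [F, hk, if_false, List.head?_cons, Option.mem_def, Option.some_inj] at hy
      rw [hy]
  have hFlast : ∀ x, ∀ y ∈ (F x).getLast?, y.1 = x.1 := by
    intro x y hy
    by_cases hk : x.1 = j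
    · simp only [F, hk, if_true] at hy
      rw [List.getLast?_append_of_ne_nil _ (List.cons_ne_nil _ _), ← List.singleton_append,
        List.getLast?_append_of_ne_nil _ hne] at hy
      rw [hlast y hy, hk]
    · simp only [F, hk, if_false, List.getLast?_singleton, Option.mem_def, Option.some_inj] at hy
      rw [hy]
  have hFne : ∀ x, F x ≠ [] := by
    intro x
    by_cases hk : x.1 = j <;> simp [F, hk]
  have hflat : ∀ L, IsReducedList L → IsReducedList (L.flatMap F) := by
    intro L hL
    refine ⟨?_, ?_⟩
    · intro y hy
      obtain ⟨x, hx, hxy⟩ := List.mem_flatMap.mp hy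
      exact (hred x (hL.1 x hx)).1 y hxy
    · rw [List.flatMap_def, List.isChain_flatten (fun hmem => by
        obtain ⟨x, _, hx⟩ := List.mem_map.mp hmem
        exact hFne x hx)]
      constructor
      · intro l' hl'
        obtain ⟨x, hx, rfl⟩ := List.mem_map.mp hl'
        exact (hred x (hL.1 x hx)).2
      · rw [List.isChain_map]
        refine hL.2.imp fun x y hxy z hz w hw => ?_
        rw [hFlast x z hz, hFhead y w hw]
        exact hxy
  obtain ⟨h, hh⟩ : of b ∈ f.range := hsurj ▸ Subgroup.mem_top _
  obtain ⟨L, hL, rfl⟩ := exists_listProd_eq h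
  rw [← listProd_flatMap f F hF] at hh
  have heq := listProd_injective (hflat L hL) (isReducedList_singleton hb) (by simpa using hh)
  cases L with
  | nil => simp at heq
  | cons x L =>
    by_cases hk : x.1 = j
    · have := congrArg List.length heq
      simp [F, hk, listInv] at this
      exact hne (List.length_eq_zero_iff.mp (by omega))
    · simp only [List.flatMap_cons, F, hk, if_false, List.singleton_append] at heq
      have := (List.cons.inj heq).1
      rw [this] at hk
      exact hk rfl

theorem exists_of_factorConj_sup_eq_top [∀ i, Nontrivial (M i)] (j : Bool) (l : List (Σ i, M i))
    (hl : IsReducedList l) (htop : factorConj (!j) 1 ⊔ factorConj j (listProd l) = ⊤) :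
    ∃ (b : M j) (a : M !j), listProd l = of b * of a := by
  induction hn : l.length using Nat.strong_induction_on generalizing l with
  | _ n ih =>
    subst hn
    by_cases hne : l = []
    · subst hne
      exact ⟨1, 1, by simp⟩
    by_cases hhead : ∀ x ∈ l.head?, x.1 ≠ j
    · by_cases hlast : ∀ x ∈ l.getLast?, x.1 = j
      · exact absurd htop (factorConj_sup_ne_top hl hne hhead hlast)
      · push Not at hlast
        obtain ⟨⟨k, a⟩, hx, hk⟩ := hlast
        obtain ⟨l', rfl⟩ := List.getLast?_eq_some_iff.mp hx
        obtain rfl : k = !j := by cases j <;> cases k <;> simp_all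
        have h1 : factorConj (!j) (1 : CoprodI M) = factorConj (!j) (1 * of a) := by
          rw [one_mul, ← mul_one (of a), factorConj_of_mul]
        simp only [listProd_append, listProd_cons, listProd_nil, mul_one] at htop ⊢
        rw [h1, factorConj_sup_eq_top_mul_right] at htop
        obtain ⟨b, a', h⟩ := ih l'.length (by simp) l' (isReducedList_append.mp hl).1 htop rfl
        exact ⟨b, a' * a, by rw [h, map_mul, mul_assoc]⟩
    · push Not at hhead
      obtain ⟨⟨k, b⟩, hx, rfl⟩ := hhead
      obtain ⟨l', rfl⟩ := List.head?_eq_some_iff.mp hx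
      simp only [listProd_cons] at htop ⊢
      rw [factorConj_of_mul] at htop
      obtain ⟨b', a, h⟩ := ih l'.length (by simp) l' hl.tail htop rfl
      exact ⟨b * b', a, by rw [h, map_mul, mul_assoc]⟩

theorem exists_common_of_factorConj_sup_eq_top [∀ i, Nontrivial (M i)] {j : Bool} {x y : CoprodI M}
    (htop : factorConj (!j) x ⊔ factorConj j y = ⊤) :
    ∃ z, factorConj (!j) x = factorConj (!j) z ∧ factorConj j y = factorConj j z := by
  rw [← factorConj_sup_eq_top_mul_right x⁻¹, mul_inv_cancel] at htop
  obtain ⟨l, hl, hlp⟩ := exists_listProd_eq (y * x⁻¹)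
  rw [← hlp] at htop
  obtain ⟨b, a, h⟩ := exists_of_factorConj_sup_eq_top j l hl htop
  refine ⟨of a * x, (factorConj_of_mul a x).symm, ?_⟩
  rw [← factorConj_of_mul b (of a * x), ← mul_assoc, ← h, hlp, inv_mul_cancel_right]

variable (M) in
/-- The vertices of the Bass–Serre tree of a free product of two groups: the conjugates of the
factors. -/
def FactorVertex : Type _ :=
  {p : Bool × Subgroup (CoprodI M) // ∃ h, p.2 = factorConj p.1 h}

/-- The vertex of the Bass–Serre tree given by the subgroup `h⁻¹ * M i * h`. -/
def factorVertex (i : Bool) (h : CoprodI M) : FactorVertex M :=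
  ⟨(i, factorConj i h), h, rfl⟩

variable (M) in
/-- The Bass–Serre tree of a free product of two groups: conjugates of distinct factors are
adjacent when they generate the whole group. -/
def factorGraph : SimpleGraph (FactorVertex M) where
  Adj p q := p.1.1 ≠ q.1.1 ∧ p.1.2 ⊔ q.1.2 = ⊤
  symm := ⟨fun p q h => ⟨h.1.symm, by rw [sup_comm, h.2]⟩⟩
  loopless := ⟨fun _ h => h.1 rfl⟩

theorem FactorVertex.exists_list (t : FactorVertex M) :
    ∃ l : List (Σ i, M i), IsReducedList l ∧ (∀ x ∈ l.head?, x.1 ≠ t.1.1) ∧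
      t = factorVertex t.1.1 (listProd l) := by
  obtain ⟨⟨i, X⟩, h, hX⟩ := t
  obtain ⟨l, hl, rfl⟩ := exists_listProd_eq h
  dsimp only at hX
  subst hX
  by_cases hi : ∀ x ∈ l.head?, x.1 ≠ i
  · exact ⟨l, hl, hi, rfl⟩
  · push Not at hi
    obtain ⟨⟨k, a⟩, hx, rfl⟩ := hi
    obtain ⟨l', rfl⟩ := List.head?_eq_some_iff.mp hx
    refine ⟨l', hl.tail, fun y hy => ((List.isChain_cons.mp hl.2).1 y hy).symm, ?_⟩
    refine Subtype.ext (Prod.ext rfl ?_)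
    simp only [factorVertex, listProd_cons, factorConj_of_mul]

theorem isTree_factorGraph [∀ i, Nontrivial (M i)] : (factorGraph M).IsTree := by
  choose word hred hhead heq using FactorVertex.exists_list (M := M)
  have huniq : ∀ (t : FactorVertex M) (l : List (Σ i, M i)), IsReducedList l →
      (∀ x ∈ l.head?, x.1 ≠ t.1.1) → t.1.2 = factorConj t.1.1 (listProd l) → word t = l := by
    intro t l hl hi ht
    refine factorConj_listProd_injective (hred t) hl (hhead t) hi ?_
    rw [← ht]
    exact (congrArg (fun s => s.1.2) (heq t)).symm
  let par : FactorVertex M → FactorVertex M := fun t =>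
    factorVertex (!t.1.1) (listProd (word t))
  let rk : FactorVertex M → ℕ := fun t => 2 * (word t).length + if t.1.1 then 0 else 1
  have hpar_eq : ∀ t s z, IsReducedList z → (∀ x ∈ z.head?, x.1 ≠ t.1.1) →
      (!t.1.1) = s.1.1 → t.1.2 = factorConj t.1.1 (listProd z) →
      s.1.2 = factorConj s.1.1 (listProd z) → par t = s ∧ word t = z := by
    intro t s z hz hi hts ht hs
    have hw := huniq t z hz hi ht
    refine ⟨Subtype.ext (Prod.ext hts ?_), hw⟩
    rw [hs, ← hts, ← hw]
    rfl
  refine (factorGraph M).isTree_of_parent (factorVertex true 1) par rk ?_ ?_ ?_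
  · intro t ht
    have h1 : word t = [] := List.length_eq_zero_iff.mp (by simp only [rk] at ht; omega)
    have h2 : t.1.1 = true := by
      by_contra h
      simp [rk, h] at ht
    rw [heq t, h1, h2, listProd_nil]
  · intro t ht
    refine ⟨⟨by simp [par, factorVertex], ?_⟩, ?_⟩
    · have h1 : t.1.2 = factorConj t.1.1 (listProd (word t)) := congrArg (fun s => s.1.2) (heq t)
      exact (congrArg (· ⊔ factorConj (!t.1.1) (listProd (word t))) h1).trans
        (factorConj_sup_factorConj_self _ _)
    · cases hw : word t with
      | nil =>
        have h2 : t.1.1 = false := by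
          by_contra h
          simp [rk, hw, h] at ht
        have : word (par t) = [] :=
          huniq _ _ (hw ▸ hred t) (by simp) (by simp [par, factorVertex, hw])
        have h3 : (par t).1.1 = true := by simp [par, factorVertex, h2]
        simp [rk, this, hw, h2, h3]
      | cons x l =>
        have hxl := hred t
        rw [hw] at hxl
        have hx : x.1 = !t.1.1 :=
          Bool.eq_not.mpr (hhead t x (by rw [hw]; rfl))
        have : word (par t) = l := by
          refine huniq _ _ hxl.tail (fun y hy => ?_) ?_
          · have := (List.isChain_cons.mp hxl.2).1 y hy
            rw [hx] at this
            exact this.symm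
          · obtain ⟨k, a⟩ := x
            dsimp only at hx
            subst hx
            simp only [par, factorVertex, hw, listProd_cons, factorConj_of_mul]
        simp only [rk, this, hw, List.length_cons]
        split_ifs <;> omega
  · intro t s hts
    obtain ⟨hne, htop⟩ := hts
    have hi : t.1.1 = !s.1.1 := Bool.eq_not.mpr hne
    obtain ⟨x, hx⟩ := t.2
    obtain ⟨y, hy⟩ := s.2
    rw [hx, hy, hi] at htop
    obtain ⟨z, hz1, hz2⟩ := exists_common_of_factorConj_sup_eq_top htop
    obtain ⟨l, hl, rfl⟩ := exists_listProd_eq z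
    rw [← hy] at hz2
    rw [← hi, ← hx] at hz1
    have hA := fun h => hpar_eq t s l hl h (by rw [hi, Bool.not_not]) hz1 hz2
    have hB := fun h => hpar_eq s t l hl h hi.symm hz2 hz1
    cases l with
    | nil =>
      cases h : t.1.1 with
      | false => exact Or.inl ⟨by simp [rk, h], (hA (by simp)).1⟩
      | true =>
        have h' : s.1.1 = false := by simpa [h] using hi
        exact Or.inr ⟨by simp [rk, h'], (hB (by simp)).1⟩
    | cons c l =>
      by_cases hc : c.1 = t.1.1
      · obtain ⟨h1, h2⟩ := hB (by simpa [hc] using hne)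
        exact Or.inr ⟨by simp [rk, h2], h1⟩
      · obtain ⟨h1, h2⟩ := hA (by simpa using hc)
        exact Or.inl ⟨by simp [rk, h2], h1⟩

/-- An automorphism preserves the conjugacy classes of the factors. -/
def PreservesFactors (φ : MulAut (CoprodI M)) : Prop :=
  ∀ i, ∃ h, φ • (of : M i →* CoprodI M).range = factorConj i h

theorem PreservesFactors.exists_smul_factorConj {φ : MulAut (CoprodI M)} (hφ : PreservesFactors φ)
    (i : Bool) (h : CoprodI M) : ∃ h', φ • factorConj i h = factorConj i h' := by
  obtain ⟨g, hg⟩ := hφ i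
  refine ⟨g * φ h, ?_⟩
  have : φ * MulAut.conj h⁻¹ = MulAut.conj (φ h)⁻¹ * φ := by
    ext x
    simp
  rw [factorConj, smul_smul, this, mul_smul, hg, conj_smul_factorConj]

/-- The action on the Bass–Serre tree of a group acting by factor-preserving automorphisms. -/
def factorPerm {P : Type*} [Group P] (f : P →* MulAut (CoprodI M))
    (hf : ∀ p, PreservesFactors (f p)) : P →* Equiv.Perm (FactorVertex M) :=
  MonoidHom.toHomPerm
    { toFun := fun p t => ⟨(t.1.1, f p • t.1.2), by
        obtain ⟨h, ht⟩ := t.2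
        rw [ht]
        exact (hf p).exists_smul_factorConj _ _⟩
      map_one' := by
        funext t
        refine Subtype.ext (Prod.ext rfl ?_)
        simp only [map_one, one_smul]
        rfl
      map_mul' := fun p q => by
        funext t
        refine Subtype.ext (Prod.ext rfl ?_)
        simp only [map_mul, mul_smul]
        rfl }

theorem factorPerm_apply_val {P : Type*} [Group P] (f : P →* MulAut (CoprodI M))
    (hf : ∀ p, PreservesFactors (f p)) (p : P) (t : FactorVertex M) :
    (factorPerm f hf p t).1 = (t.1.1, f p • t.1.2) := rfl

theorem factorGraph_adj_factorPerm {P : Type*} [Group P] (f : P →* MulAut (CoprodI M))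
    (hf : ∀ p, PreservesFactors (f p)) (p : P) {s t : FactorVertex M}
    (h : (factorGraph M).Adj s t) :
    (factorGraph M).Adj (factorPerm f hf p s) (factorPerm f hf p t) := by
  refine ⟨h.1, ?_⟩
  rw [factorPerm_apply_val, factorPerm_apply_val]
  dsimp only
  rw [← Subgroup.smul_sup, h.2, eq_top_iff]
  intro z _
  rw [Subgroup.mem_pointwise_smul_iff_inv_smul_mem]
  exact Subgroup.mem_top _

theorem exists_factorPerm_ne [∀ i, Nontrivial (M i)] {P : Type*} [Group P]
    (f : P →* MulAut (CoprodI M)) (hf : ∀ p, PreservesFactors (f p))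
    (hconj : ∀ h, ∃ p, f p = MulAut.conj h) (t : FactorVertex M) :
    ∃ p, factorPerm f hf p t ≠ t := by
  by_contra! hfix
  obtain ⟨h, ht⟩ := t.2
  have hall : ∀ g, factorConj t.1.1 (h * g) = factorConj t.1.1 h := by
    intro g
    obtain ⟨p, hp⟩ := hconj g⁻¹
    have := congrArg (fun s => s.1.2) (hfix p)
    rw [factorPerm_apply_val] at this
    dsimp only at this
    rwa [ht, hp, conj_smul_factorConj] at this
  obtain ⟨b, hb⟩ := exists_ne (1 : M !t.1.1)
  have h1 := hall h⁻¹
  have h2 := hall (h⁻¹ * of b)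
  rw [mul_inv_cancel] at h1
  rw [mul_inv_cancel_left, ← h1] at h2
  have := factorConj_listProd_injective (l := [⟨_, b⟩]) (l' := []) (i := t.1.1)
    (isReducedList_singleton hb) ⟨by simp, .nil⟩ (by simp) (by simp) (by simpa using h2)
  exact List.cons_ne_nil _ _ this

end Bool

end Monoid.CoprodI

namespace GraphProduct

section TwoVertices

variable {V : Type*} (Γ : SimpleGraph V) (G : V → Type*) [∀ w, Group (G w)]

variable {Γ G} in
theorem hom_ext {N : Type*} [Monoid N] {f g : GraphProduct Γ G →* N}
    (h : ∀ w x, f (of Γ G w x) = g (of Γ G w x)) : f = g := by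
  apply QuotientGroup.monoidHom_ext
  apply Monoid.CoprodI.ext_hom
  intro w
  ext x
  exact h w x

/-- For pairwise non-adjacent vertices, the graph product retracts onto the free product of their
vertex groups, killing all the other vertex groups. -/
theorem exists_retraction {ι : Type*} (s : ι → V) (hs : Function.Injective s)
    (hadj : ∀ i j, ¬ Γ.Adj (s i) (s j)) :
    ∃ p : GraphProduct Γ G →* Monoid.CoprodI (fun i => G (s i)),
      (∀ i x, p (of Γ G (s i) x) = Monoid.CoprodI.of (i := i) x) ∧
      ∀ w, w ∉ Set.range s → ∀ x, p (of Γ G w x) = 1 := by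
  have hex : ∀ w, ∃ f : G w →* Monoid.CoprodI (fun i => G (s i)),
      (∀ i (e : s i = w) (x : G (s i)), f (e ▸ x) = Monoid.CoprodI.of (i := i) x) ∧
      (w ∉ Set.range s → ∀ x, f x = 1) := by
    intro w
    by_cases hw : w ∈ Set.range s
    · obtain ⟨i, rfl⟩ := hw
      refine ⟨Monoid.CoprodI.of (M := fun i => G (s i)) (i := i), fun j e x => ?_,
        fun h => absurd ⟨i, rfl⟩ h⟩
      obtain rfl := hs e
      rfl
    · exact ⟨1, fun i e => absurd ⟨i, e⟩ hw, fun _ _ => rfl⟩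
  choose f hf1 hf2 using hex
  have hker : Subgroup.normalClosure (graphProdRels Γ G) ≤ (Monoid.CoprodI.lift f).ker := by
    apply Subgroup.normalClosure_le_normal
    rintro _ ⟨u, v, huv, g, h, rfl⟩
    rw [SetLike.mem_coe, MonoidHom.mem_ker]
    simp only [map_mul, map_inv, Monoid.CoprodI.lift_of]
    by_cases hu : u ∈ Set.range s
    · have hv : v ∉ Set.range s := by
        rintro ⟨j, rfl⟩
        obtain ⟨i, rfl⟩ := hu
        exact hadj i j huv
      simp [hf2 v hv]
    · simp [hf2 u hu]
  refine ⟨QuotientGroup.lift _ (Monoid.CoprodI.lift f) hker, fun i x => ?_, fun w hw x => ?_⟩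
  · exact (Monoid.CoprodI.lift_of f x).trans (hf1 (s i) i rfl x)
  · exact (Monoid.CoprodI.lift_of f x).trans (hf2 w hw x)

/-- Partially conjugating automorphisms descend to the free product of the vertex groups of
pairwise non-adjacent vertices. -/
theorem exists_induced_hom {ι : Type*} (s : ι → V) (P : Subgroup (MulAut (GraphProduct Γ G)))
    (hP : ∀ φ ∈ P, IsPConjugating Γ G φ)
    (p : GraphProduct Γ G →* Monoid.CoprodI (fun i => G (s i)))
    (hp1 : ∀ i x, p (of Γ G (s i) x) = Monoid.CoprodI.of (i := i) x)
    (hp2 : ∀ w, w ∉ Set.range s → ∀ x, p (of Γ G w x) = 1) :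
    ∃ f : P →* MulAut (Monoid.CoprodI (fun i => G (s i))), ∀ φ x, f φ (p x) = p (φ.1 x) := by
  let σ : Monoid.CoprodI (fun i => G (s i)) →* GraphProduct Γ G :=
    Monoid.CoprodI.lift fun i => of Γ G (s i)
  have hpσ : ∀ y, p (σ y) = y := by
    intro y
    have : p.comp σ = MonoidHom.id _ := by
      apply Monoid.CoprodI.ext_hom
      intro i
      ext x
      simp [σ, hp1]
    exact DFunLike.congr_fun this y
  have hcomm : ∀ φ ∈ P, ∀ x, p (φ (σ (p x))) = p (φ x) := by
    intro φ hφ x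
    have : (p.comp φ.toMonoidHom).comp (σ.comp p) = p.comp φ.toMonoidHom := by
      apply hom_ext
      intro w x
      by_cases hw : w ∈ Set.range s
      · obtain ⟨i, rfl⟩ := hw
        simp [hp1, σ]
      · obtain ⟨g, hg⟩ := hP φ hφ w
        have hmem : φ (of Γ G w x) ∈ Subgroup.map (MulAut.conj g).toMonoidHom
            (vertexSubgroup Γ G w) := by
          rw [← hg]
          exact ⟨_, ⟨x, rfl⟩, rfl⟩
        obtain ⟨_, ⟨x', rfl⟩, hx'⟩ := hmem
        have : p (φ (of Γ G w x)) = 1 := by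
          rw [← hx']
          simp [hp2 w hw]
        simp [hp2 w hw, this]
    exact DFunLike.congr_fun this x
  let e : P →* Monoid.End (Monoid.CoprodI (fun i => G (s i))) :=
    { toFun := fun φ => (p.comp φ.1.toMonoidHom).comp σ
      map_one' := by
        refine DFunLike.ext _ _ fun y => ?_
        exact hpσ y
      map_mul' := fun φ ψ => by
        refine DFunLike.ext _ _ fun y => ?_
        exact (hcomm φ.1 φ.2 (ψ.1 (σ y))).symm }
  have hinv : ∀ (φ ψ : P), φ * ψ = 1 → ∀ y, e φ (e ψ y) = y := by
    intro φ ψ h y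
    have := DFunLike.congr_fun (e.map_mul φ ψ) y
    rw [h, map_one] at this
    exact this.symm
  refine ⟨
    { toFun := fun φ =>
        { toFun := e φ
          invFun := e φ⁻¹
          left_inv := hinv _ _ (inv_mul_cancel φ)
          right_inv := hinv _ _ (mul_inv_cancel φ)
          map_mul' := map_mul (e φ) }
      map_one' := MulEquiv.ext fun y => DFunLike.congr_fun e.map_one y
      map_mul' := fun φ ψ => MulEquiv.ext fun y => DFunLike.congr_fun (e.map_mul φ ψ) y },
    fun φ x => hcomm φ.1 φ.2 x⟩

end TwoVertices

theorem isPConjugating_conj {V : Type*} (Γ : SimpleGraph V) (G : V → Type*) [∀ w, Group (G w)]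
    (g : GraphProduct Γ G) : IsPConjugating Γ G (MulAut.conj g) :=
  fun _ => ⟨g, rfl⟩

end GraphProduct

/-- Main theorem (first assertion): if `Γ` is not complete then `PConjAut(Γ𝒢)` has a quotient
`Q` acting on a simplicial tree without a global fixed vertex. -/
theorem pConjAut_quotient_acts_on_tree {V : Type} (Γ : SimpleGraph V) (G : V → Type)
    [∀ w, Group (G w)] [∀ w, Nontrivial (G w)]
    (P : Subgroup (MulAut (GraphProduct Γ G)))
    (hP : ∀ φ : MulAut (GraphProduct Γ G), φ ∈ P ↔ IsPConjugating Γ G φ)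
    (hΓ : ∃ u v : V, u ≠ v ∧ ¬Γ.Adj u v) :
    ∃ (Q : Type) (hQ : Group Q),
      haveI := hQ
      ∃ π : P →* Q, Function.Surjective π ∧
        ∃ (T : Type) (tr : SimpleGraph T), tr.IsTree ∧
          ∃ ρ : Q →* Equiv.Perm T,
            (∀ (q : Q) (a b : T), tr.Adj a b → tr.Adj (ρ q a) (ρ q b)) ∧
            ¬∃ x : T, ∀ q : Q, ρ q x = x := by
  obtain ⟨u, v, huv, hnadj⟩ := hΓ
  let s : Bool → V := fun b => cond b u v
  have hs : Function.Injective s := by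
    intro a b hab
    cases a <;> cases b <;> simp_all [s, eq_comm]
  have hadj : ∀ i j, ¬ Γ.Adj (s i) (s j) := by
    intro i j
    cases i <;> cases j <;> simp [s, hnadj, Γ.adj_comm v u]
  obtain ⟨p, hp1, hp2⟩ := GraphProduct.exists_retraction Γ G s hs hadj
  obtain ⟨f, hf⟩ :=
    GraphProduct.exists_induced_hom Γ G s P (fun φ => (hP φ).mp) p hp1 hp2
  have hpsurj : Function.Surjective p := by
    intro y
    induction y using Monoid.CoprodI.induction_on with
    | one => exact ⟨1, map_one p⟩
    | of i x => exact ⟨_, hp1 i x⟩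
    | mul x y hx hy =>
      obtain ⟨x, rfl⟩ := hx
      obtain ⟨y, rfl⟩ := hy
      exact ⟨x * y, map_mul p x y⟩
  have hmap : ∀ i, (GraphProduct.of Γ G (s i)).range.map p =
      (Monoid.CoprodI.of (M := fun i => G (s i)) (i := i)).range := by
    intro i
    rw [MonoidHom.map_range]
    congr 1
    ext x
    exact hp1 i x
  have hpres : ∀ φ, Monoid.CoprodI.PreservesFactors (f φ) := by
    intro φ i
    obtain ⟨g, hg⟩ := (hP φ.1).mp φ.2 (s i)
    refine ⟨(p g)⁻¹, ?_⟩
    have h1 : ∀ (α : MulAut (GraphProduct Γ G))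
        (β : MulAut (Monoid.CoprodI fun i => G (s i))), (∀ x, β (p x) = p (α x)) →
        ((vertexSubgroup Γ G (s i)).map α.toMonoidHom).map p =
          β • (Monoid.CoprodI.of (M := fun i => G (s i)) (i := i)).range := by
      intro α β h
      have hcomp : p.comp α.toMonoidHom = β.toMonoidHom.comp p :=
        MonoidHom.ext fun x => (h x).symm
      rw [← hmap, Subgroup.map_map, hcomp, ← Subgroup.map_map]
      rfl
    rw [Monoid.CoprodI.factorConj, inv_inv, ← h1 φ.1 (f φ) (hf φ), hg]
    exact h1 _ _ fun x => by simp
  refine ⟨P, inferInstance, MonoidHom.id P, Function.surjective_id,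
    Monoid.CoprodI.FactorVertex (fun i => G (s i)), Monoid.CoprodI.factorGraph _,
    Monoid.CoprodI.isTree_factorGraph, Monoid.CoprodI.factorPerm f hpres,
    fun q a b => Monoid.CoprodI.factorGraph_adj_factorPerm f hpres q, ?_⟩
  rintro ⟨t, ht⟩
  obtain ⟨q, hq⟩ := Monoid.CoprodI.exists_factorPerm_ne f hpres (fun h => by
    obtain ⟨g, rfl⟩ := hpsurj h
    refine ⟨⟨MulAut.conj g, (hP _).mpr (GraphProduct.isPConjugating_conj Γ G g)⟩, ?_⟩
    refine MulEquiv.ext fun y => ?_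
    obtain ⟨x, rfl⟩ := hpsurj y
    rw [hf]
    simp) t
  exact hq (ht q)
end

section
/- Let Γ be a finite simplicial graph. The automorphism group Aut(C_Γ) of the right-angled Coxeter group C_Γ is SQ-universal if and only if some vertex of Γ is non-adjacent to at least two other vertices of Γ. -/
section

open Equiv
open scoped commutatorElement MatrixGroups
open Matrix (ProjGenLinGroup)

/-- The permutation of `Y × ℤ` acting by `h n` on the fibre over `n`. -/
def fiberwisePerm (Y : Type*) : (ℤ → Perm Y) →* Perm (Y × ℤ) where
  toFun h := Equiv.prodCongrLeft h
  map_one' := by ext x <;> rfl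
  map_mul' _ _ := by ext x <;> rfl

@[simp] lemma fiberwisePerm_apply {Y : Type*} (h : ℤ → Perm Y) (y : Y) (n : ℤ) :
    fiberwisePerm Y h (y, n) = (h n y, n) := rfl

/-- The translation of `Y × ℤ` by one in the second coordinate. -/
def shiftPerm (Y : Type*) : Perm (Y × ℤ) := (Equiv.refl Y).prodCongr (Equiv.addRight 1)

lemma shiftPerm_pow_apply {Y : Type*} (k : ℕ) (y : Y) (n : ℤ) :
    (shiftPerm Y ^ k) (y, n) = (y, n + k) := by
  induction k with
  | zero => simp
  | succ k ih => rw [pow_succ', Perm.mul_apply, ih]; simp [shiftPerm, add_assoc]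

lemma fiberwisePerm_mul_shiftPerm_pow {Y : Type*} (h : ℤ → Perm Y) (k : ℕ) :
    fiberwisePerm Y h * shiftPerm Y ^ k =
      shiftPerm Y ^ k * fiberwisePerm Y (fun n => h (n + k)) := by
  ext ⟨y, n⟩ <;> simp [shiftPerm_pow_apply]

lemma fiberwisePerm_injective (Y : Type*) : Function.Injective (fiberwisePerm Y) := by
  intro h h' hh
  funext n
  ext y
  simpa using congrArg Prod.fst (congrArg (fun p : Perm (Y × ℤ) => p (y, n)) hh)

/-- A permutation of `Y` acting on the fibre over zero and trivially elsewhere. -/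
def baseFiberPerm (Y : Type*) : Perm Y →* Perm (Y × ℤ) :=
  (fiberwisePerm Y).comp (MonoidHom.mulSingle (fun _ : ℤ => Perm Y) 0)

lemma baseFiberPerm_injective (Y : Type*) : Function.Injective (baseFiberPerm Y) :=
  (fiberwisePerm_injective Y).comp (Pi.mulSingle_injective (M := fun _ : ℤ => Perm Y) (0 : ℤ))

lemma fiberwisePerm_step_commutator_shiftPerm {Y : Type*} (g : Perm Y) :
    ⁅fiberwisePerm Y (fun n => if 0 ≤ n then g else 1), shiftPerm Y⁆ = baseFiberPerm Y g := by
  rw [commutatorElement_def, mul_inv_eq_iff_eq_mul, mul_inv_eq_iff_eq_mul]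
  ext ⟨y, n⟩
  · simp [shiftPerm, baseFiberPerm]
    by_cases h : n = -1
    · subst h; simp
    · rw [Pi.mulSingle_eq_of_ne (by omega)]
      by_cases h0 : 0 ≤ n
      · simp [h0, show 0 ≤ n + 1 by omega]
      · simp [h0, show ¬ 0 ≤ n + 1 by omega]
  · simp [shiftPerm, baseFiberPerm]

/-- The family indexed by `ℤ` with value `c i` at `2 ^ i` and trivial elsewhere. -/
noncomputable def sparse {U : Type*} [Group U] (c : ℕ → U) (n : ℤ) : U := by
  classical exact if h : ∃ i : ℕ, n = 2 ^ i then c h.choose else 1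

lemma sparse_pow {U : Type*} [Group U] (c : ℕ → U) (i : ℕ) : sparse c (2 ^ i) = c i := by
  have h : ∃ j : ℕ, (2 : ℤ) ^ i = 2 ^ j := ⟨i, rfl⟩
  unfold sparse
  rw [dif_pos h]
  congr 1
  exact Int.pow_right_injective (by norm_num : 1 < (2 : ℤ).natAbs) h.choose_spec.symm

lemma sparse_eq_one {U : Type*} [Group U] (c : ℕ → U) {n : ℤ} (h : ¬ ∃ i : ℕ, n = 2 ^ i) :
    sparse c n = 1 := by
  unfold sparse; rw [dif_neg h]

lemma sidon {n : ℤ} {i j k l : ℕ} (hij : i ≠ j) (h1 : n + 2 ^ i = 2 ^ k) (h2 : n + 2 ^ j = 2 ^ l) :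
    n = 0 := by
  have key : ∀ {i j k l : ℕ}, i < j → 2 ^ k + 2 ^ j = 2 ^ l + 2 ^ i → k = i := by
    intro i j k l hij h
    have hlt : 2 ^ i < 2 ^ j := Nat.pow_lt_pow_right (by norm_num) hij
    have hkl : 2 ^ k < 2 ^ l := by omega
    have hkl' : k < l := (Nat.pow_lt_pow_iff_right (by norm_num)).1 hkl
    obtain ⟨a, rfl⟩ := Nat.exists_eq_add_of_lt hij
    obtain ⟨b, rfl⟩ := Nat.exists_eq_add_of_lt hkl'
    rcases lt_trichotomy k i with hki | hki | hki
    · exfalso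
      obtain ⟨d, rfl⟩ := Nat.exists_eq_add_of_lt hki
      have : 2 ^ k * (1 + 2 ^ (d + 1) * 2 ^ (a + 1)) = 2 ^ k * (2 ^ (b + 1) + 2 ^ (d + 1)) := by
        ring_nf at h ⊢; omega
      have := Nat.eq_of_mul_eq_mul_left (by positivity) this
      rw [pow_succ, pow_succ, pow_succ] at this
      have h3 : 2 ^ d * 2 * (2 ^ a * 2) = 2 * (2 ^ d  * (2 ^ a * 2)) := by ring
      omega
    · exact hki
    · exfalso
      obtain ⟨d, rfl⟩ := Nat.exists_eq_add_of_lt hki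
      have : 2 ^ i * (2 ^ (d + 1) + 2 ^ (a + 1)) = 2 ^ i * (2 ^ (d + 1) * 2 ^ (b + 1) + 1) := by
        ring_nf at h ⊢; omega
      have := Nat.eq_of_mul_eq_mul_left (by positivity) this
      rw [pow_succ, pow_succ, pow_succ] at this
      have h3 : 2 ^ d * 2 * (2 ^ b * 2) = 2 * (2 ^ d  * (2 ^ b * 2)) := by ring
      omega
  have h3 : (2 : ℤ) ^ k + 2 ^ j = 2 ^ l + 2 ^ i := by linarith
  have h4 : 2 ^ k + 2 ^ j = 2 ^ l + 2 ^ i := by exact_mod_cast h3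
  rcases lt_or_gt_of_ne hij with h | h
  · have := key h h4; subst this; linarith
  · have := key h h4.symm; subst this; linarith

/-- The permutation acting by `c k` on the fibre over `2 ^ k - 2 ^ i` for each `k`. -/
noncomputable def codedPerm {Y : Type*} (c : ℕ → Perm Y) (i : ℕ) : Perm (Y × ℤ) :=
  fiberwisePerm Y (fun n => sparse c (n + 2 ^ i))

lemma codedPerm_eq {Y : Type*} (c : ℕ → Perm Y) (i : ℕ) :
    codedPerm c i = (shiftPerm Y ^ (2 ^ i))⁻¹ * fiberwisePerm Y (sparse c) *
      shiftPerm Y ^ (2 ^ i) := by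
  rw [mul_assoc, fiberwisePerm_mul_shiftPerm_pow, inv_mul_cancel_left]
  simp [codedPerm]

lemma codedPerm_conj {Y : Type*} (c : ℕ → Perm Y) (i : ℕ) (x : Perm Y) :
    codedPerm c i * baseFiberPerm Y x * (codedPerm c i)⁻¹ =
      baseFiberPerm Y (c i * x * (c i)⁻¹) := by
  unfold codedPerm baseFiberPerm
  simp only [MonoidHom.comp_apply, ← map_mul, ← map_inv]
  congr 1
  funext n
  by_cases h : n = 0
  · subst h; simp [sparse_pow]
  · simp [h, Pi.mulSingle_eq_of_ne]

lemma codedPerm_commutator {Y : Type*} (c : ℕ → Perm Y) {i j : ℕ} (hij : i ≠ j) :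
    ⁅codedPerm c i, codedPerm c j⁆ = baseFiberPerm Y ⁅c i, c j⁆ := by
  unfold codedPerm baseFiberPerm
  simp only [commutatorElement_def, MonoidHom.comp_apply, ← map_mul, ← map_inv]
  congr 1
  funext n
  by_cases h : n = 0
  · subst h; simp [sparse_pow]
  · by_cases h1 : ∃ k : ℕ, n + 2 ^ i = 2 ^ k
    · by_cases h2 : ∃ k : ℕ, n + 2 ^ j = 2 ^ k
      · obtain ⟨k, h1⟩ := h1
        obtain ⟨l, h2⟩ := h2
        exact absurd (sidon hij h1 h2) h
      · simp [sparse_eq_one c h2, h, Pi.mulSingle_eq_of_ne]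
    · simp [sparse_eq_one c h1, h, Pi.mulSingle_eq_of_ne]

lemma viaEmbedding_disjoint_conj {A X : Type*} (κ : A ↪ X) (g : Perm X)
    (hg : ∀ a b, g (κ a) ≠ κ b) (x y : Perm A) :
    Perm.Disjoint (g * Perm.viaEmbeddingHom κ x * g⁻¹) (Perm.viaEmbeddingHom κ y) := by
  intro z
  by_cases hz : z ∈ Set.range κ
  · left
    have : g⁻¹ z ∉ Set.range κ := by
      rintro ⟨a, ha⟩
      obtain ⟨b, rfl⟩ := hz
      exact hg a b (by rw [ha]; simp)
    simp only [Perm.mul_apply, Perm.viaEmbeddingHom_apply]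
    rw [Perm.viaEmbedding_apply_of_notMem _ _ _ this]
    simp
  · right
    exact Perm.viaEmbedding_apply_of_notMem _ _ _ hz

lemma viaEmbedding_commutator_conj {A X : Type*} (κ : A ↪ X) (g : Perm X)
    (hg : ∀ a b, g (κ a) ≠ κ b) (x y : Perm A) :
    ⁅⁅Perm.viaEmbeddingHom κ x, g⁆, Perm.viaEmbeddingHom κ y⁆ =
      Perm.viaEmbeddingHom κ ⁅x, y⁆ := by
  have h := (viaEmbedding_disjoint_conj κ g hg x⁻¹ y).commute
  rw [map_inv] at h
  set f := Perm.viaEmbeddingHom κ x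
  set t := Perm.viaEmbeddingHom κ y
  have e : ⁅f, g⁆ = f * (g * f⁻¹ * g⁻¹) := by simp only [commutatorElement_def, mul_assoc]
  rw [e, map_commutatorElement]
  set h' := g * f⁻¹ * g⁻¹
  simp only [commutatorElement_def, mul_inv_rev]
  calc f * h' * t * (h'⁻¹ * f⁻¹) * t⁻¹ = f * (h' * t) * h'⁻¹ * f⁻¹ * t⁻¹ := by group
    _ = f * t * f⁻¹ * t⁻¹ := by rw [h.eq]; group

lemma exists_perm_comp_embedding {A X : Type*} [Countable X] (i j : A ↪ X)
    (hi : (Set.range i)ᶜ.Infinite) (hj : (Set.range j)ᶜ.Infinite) :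
    ∃ τ : Perm X, ∀ a, τ (i a) = j a := by
  classical
  have := hi.to_subtype
  have := hj.to_subtype
  obtain ⟨c⟩ := nonempty_equiv_of_countable (α := ↥(Set.range i)ᶜ) (β := ↥(Set.range j)ᶜ)
  let r : Set.range i ≃ Set.range j :=
    (Equiv.ofInjective i i.injective).symm.trans (Equiv.ofInjective j j.injective)
  refine ⟨(Equiv.Set.sumCompl _).symm.trans ((r.sumCongr c).trans (Equiv.Set.sumCompl _)), ?_⟩
  intro a
  have h : (Equiv.Set.sumCompl (Set.range i)).symm (i a) = Sum.inl ⟨i a, a, rfl⟩ :=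
    Equiv.Set.sumCompl_symm_apply_of_mem (Set.mem_range_self a)
  have h2 : (Equiv.ofInjective i i.injective).symm ⟨i a, a, rfl⟩ = a := by
    rw [Equiv.symm_apply_eq]; rfl
  simp only [Equiv.trans_apply, h, Equiv.sumCongr_apply, Sum.map_inl,
    Equiv.Set.sumCompl_apply_inl, r, h2, Equiv.ofInjective_apply]

lemma exists_perm_data (Q : Type) [Group Q] [Countable Q] :
    ∃ (X : Type) (α β : Q →* Perm X) (f : Q → Perm X) (t τ : Perm X),
      Function.Injective α ∧ (∀ q, ⁅f q, t⁆ = β q) ∧ (∀ q, τ * α q * τ⁻¹ = β q) ∧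
      ∀ p q, q ≠ 1 → ⁅⁅f p, α q⁆, t⁆ = β p := by
  let P := Q × ℕ
  let X := P ⊕ ℕ
  obtain ⟨e⟩ := nonempty_equiv_of_countable (α := ℕ) (β := P × ℤ)
  let act : Q →* Perm P :=
    { toFun := fun q => (Equiv.mulLeft q).prodCongr (Equiv.refl ℕ)
      map_one' := by ext x <;> simp
      map_mul' := fun a b => by ext x <;> simp [mul_assoc] }
  have hact : ∀ q (x : P), act q x = (q * x.1, x.2) := fun _ _ => rfl
  let i : P ↪ X := ⟨Sum.inl, Sum.inl_injective⟩
  let κ : P × ℤ ↪ X := ⟨fun x => Sum.inl (1, e.symm x), fun x y h =>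
    e.symm.injective (congrArg Prod.snd (Sum.inl_injective h))⟩
  let j : P ↪ X := ⟨fun p => κ (p, 0), fun x y h =>
    congrArg Prod.fst (κ.injective h)⟩
  have hcompl : ∀ k : P ↪ X, (∀ p, ∃ p', k p = Sum.inl p') → (Set.range k)ᶜ.Infinite := by
    intro k hk
    refine (Set.infinite_range_of_injective (Sum.inr_injective : Function.Injective
      (Sum.inr : ℕ → X))).mono ?_
    rintro _ ⟨n, rfl⟩ ⟨p, hp⟩
    obtain ⟨p', hp'⟩ := hk p
    rw [hp'] at hp
    cases hp
  obtain ⟨τ, hτ⟩ := exists_perm_comp_embedding i j (hcompl i fun p => ⟨p, rfl⟩)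
    (hcompl j fun p => ⟨_, rfl⟩)
  have hstep : ∀ g : Perm P,
      Perm.viaEmbeddingHom κ (baseFiberPerm P g) = Perm.viaEmbeddingHom j g := by
    intro g
    ext x
    simp only [Perm.viaEmbeddingHom_apply]
    by_cases hx : x ∈ Set.range κ
    · obtain ⟨⟨p, n⟩, rfl⟩ := hx
      rw [Perm.viaEmbedding_apply]
      by_cases hn : n = 0
      · subst hn
        have : κ (p, 0) = j p := rfl
        rw [this, Perm.viaEmbedding_apply]
        simp only [baseFiberPerm, MonoidHom.comp_apply, MonoidHom.mulSingle_apply,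
          fiberwisePerm_apply, Pi.mulSingle_eq_same]
        rfl
      · rw [Perm.viaEmbedding_apply_of_notMem]
        · simp [baseFiberPerm, hn]
        · rintro ⟨p', hp'⟩
          have := κ.injective hp'
          simp at this
          exact hn this.2.symm
    · rw [Perm.viaEmbedding_apply_of_notMem _ _ _ hx, Perm.viaEmbedding_apply_of_notMem]
      rintro ⟨p, rfl⟩
      exact hx ⟨(p, 0), rfl⟩
  refine ⟨X, (Perm.viaEmbeddingHom i).comp act, (Perm.viaEmbeddingHom j).comp act,
    fun q => Perm.viaEmbeddingHom κ (fiberwisePerm P fun n => if 0 ≤ n then act q else 1),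
    Perm.viaEmbeddingHom κ (shiftPerm P), τ, ?_, ?_, ?_, ?_⟩
  · intro a b hab
    have := congrArg (fun g : Perm X => g (i (1, 0))) hab
    simp only [MonoidHom.comp_apply, Perm.viaEmbeddingHom_apply, Perm.viaEmbedding_apply,
      hact] at this
    simpa using congrArg Prod.fst (i.injective this)
  · intro q
    rw [← map_commutatorElement, fiberwisePerm_step_commutator_shiftPerm, hstep]; rfl
  · intro q
    rw [mul_inv_eq_iff_eq_mul]
    ext x
    simp only [Perm.mul_apply, MonoidHom.comp_apply, Perm.viaEmbeddingHom_apply]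
    by_cases hx : x ∈ Set.range i
    · obtain ⟨p, rfl⟩ := hx
      rw [Perm.viaEmbedding_apply, hτ, hτ, Perm.viaEmbedding_apply]
    · rw [Perm.viaEmbedding_apply_of_notMem _ _ _ hx, Perm.viaEmbedding_apply_of_notMem]
      rintro ⟨p, hp⟩
      rw [← hτ] at hp
      exact hx ⟨p, τ.injective hp⟩
  · intro p q hq
    rw [viaEmbedding_commutator_conj, fiberwisePerm_step_commutator_shiftPerm, hstep]
    · rfl
    · rintro a b hab
      have h1 : κ a = i (1, e.symm a) := rfl
      have h2 : κ b = i (1, e.symm b) := rfl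
      rw [h1, h2, MonoidHom.comp_apply, Perm.viaEmbeddingHom_apply, Perm.viaEmbedding_apply,
        hact] at hab
      have := congrArg Prod.fst (i.injective hab)
      simp at this
      exact hq this

lemma exists_normal_maximal_avoiding {S Q : Type*} [Group S] [Group Q] (j : Q →* S)
    (hj : Function.Injective j)
    (h : ∀ N : Subgroup S, N.Normal → ∀ q, q ≠ 1 → j q ∈ N → ∀ p, j p ∈ N) :
    ∃ M : Subgroup S, M.Normal ∧ (∀ q, j q ∈ M → q = 1) ∧
      ∀ N : Subgroup S, N.Normal → M < N → ∀ p, j p ∈ N := by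
  obtain ⟨M, -, hM⟩ := zorn_le_nonempty₀ {M : Subgroup S | M.Normal ∧ ∀ q, j q ∈ M → q = 1}
    (fun c hc hchain y hy => by
      have hdir : DirectedOn (· ≤ ·) c := hchain.directedOn
      refine ⟨sSup c, ⟨⟨?_⟩, ?_⟩, fun z hz => le_sSup hz⟩
      · intro n hn g
        rw [Subgroup.mem_sSup_of_directedOn ⟨y, hy⟩ hdir] at hn ⊢
        obtain ⟨s, hs, hns⟩ := hn
        exact ⟨s, hs, (hc hs).1.conj_mem n hns g⟩
      · intro q hq
        rw [Subgroup.mem_sSup_of_directedOn ⟨y, hy⟩ hdir] at hq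
        obtain ⟨s, hs, hns⟩ := hq
        exact (hc hs).2 q hns) ⊥ ⟨inferInstance, fun q hq => hj (by simpa using hq)⟩
  refine ⟨M, hM.prop.1, hM.prop.2, fun N hN hlt => ?_⟩
  by_contra! hcon
  obtain ⟨p, hp⟩ := hcon
  refine hlt.not_ge (hM.2 ⟨hN, fun q hq => ?_⟩ hlt.le)
  by_contra hq1
  exact hp (h N hN q hq1 hq p)

lemma exists_two_generated_monolithic (Q : Type) [Group Q] [Countable Q] :
    ∃ (T : Type) (_ : Group T) (π : FreeGroup (Fin 2) →* T) (j : Q →* T),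
      Function.Surjective π ∧ Function.Injective j ∧
      ∀ N : Subgroup T, N.Normal → N ≠ ⊥ → ∀ q, j q ∈ N := by
  obtain ⟨X, α, β, f, t, τ, hα, h1, h2, h3⟩ := exists_perm_data Q
  obtain ⟨enc, henc⟩ := exists_injective_nat (Option (Option Q))
  let g : Option (Option Q) → Perm X := fun k => k.elim τ (fun k => k.elim t f)
  let c : ℕ → Perm X := Function.extend enc g 1
  have hc : ∀ k, c (enc k) = g k := fun k => henc.extend_apply g 1 k
  let ψ : FreeGroup (Fin 2) →* Perm (X × ℤ) :=
    FreeGroup.lift ![fiberwisePerm X (sparse c), shiftPerm X]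
  let S := ψ.range
  have hs : fiberwisePerm X (sparse c) ∈ S := ⟨FreeGroup.of 0, by simp [ψ]⟩
  have ht : shiftPerm X ∈ S := ⟨FreeGroup.of 1, by simp [ψ]⟩
  have hcod : ∀ i, codedPerm c i ∈ S := fun i => by
    rw [codedPerm_eq]
    exact S.mul_mem (S.mul_mem (S.inv_mem (S.pow_mem ht _)) hs) (S.pow_mem ht _)
  let F : Option (Option Q) → S := fun k => ⟨codedPerm c (enc k), hcod _⟩
  have hβ : ∀ q, baseFiberPerm X (β q) ∈ S := fun q => by
    rw [← h1, show f q = c (enc (some (some q))) from (hc (some (some q))).symm,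
      show t = c (enc (some none)) from (hc (some none)).symm,
      ← codedPerm_commutator c (fun h => by simpa using henc h)]
    exact S.mul_mem (S.mul_mem (S.mul_mem (hcod _) (hcod _)) (S.inv_mem (hcod _)))
      (S.inv_mem (hcod _))
  have hαβ : ∀ q, baseFiberPerm X (α q) =
      (codedPerm c (enc none))⁻¹ * baseFiberPerm X (β q) * codedPerm c (enc none) := fun q => by
    rw [← h2, show τ = c (enc none) from (hc none).symm, ← codedPerm_conj]
    group
  have hαS : ∀ q, baseFiberPerm X (α q) ∈ S := fun q => by
    rw [hαβ]
    exact S.mul_mem (S.mul_mem (S.inv_mem (hcod _)) (hβ q)) (hcod _)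
  let j₀ : Q →* S := ((baseFiberPerm X).comp α).codRestrict S hαS
  have hj₀ : Function.Injective j₀ := fun a b hab =>
    hα (baseFiberPerm_injective X (congrArg Subtype.val hab))
  have hN : ∀ N : Subgroup S, N.Normal → ∀ q, q ≠ 1 → j₀ q ∈ N → ∀ p, j₀ p ∈ N := by
    intro N hN q hq hqN p
    have hcomm : ⁅⁅F (some (some p)), j₀ q⁆, F (some none)⁆ ∈ N := by
      have : ⁅F (some (some p)), j₀ q⁆ ∈ N :=
        N.mul_mem (hN.conj_mem _ hqN _) (N.inv_mem hqN)
      rw [commutatorElement_def, mul_assoc, mul_assoc]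
      refine N.mul_mem this ?_
      rw [← mul_assoc]
      exact hN.conj_mem _ (N.inv_mem this) _
    have hval : ((⁅⁅F (some (some p)), j₀ q⁆, F (some none)⁆ : S) : Perm (X × ℤ)) =
        baseFiberPerm X (β p) := by
      have e1 : ((⁅F (some (some p)), j₀ q⁆ : S) : Perm (X × ℤ)) =
          baseFiberPerm X ⁅f p, α q⁆ := by
        rw [commutatorElement_def, commutatorElement_def, map_mul, map_inv]
        have := codedPerm_conj c (enc (some (some p))) (α q)
        rw [hc] at this
        rw [show f p = g (some (some p)) from rfl, ← this]
        rfl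
      have e2 : ((⁅⁅F (some (some p)), j₀ q⁆, F (some none)⁆ : S) : Perm (X × ℤ)) =
          ((⁅F (some (some p)), j₀ q⁆ : S) : Perm (X × ℤ)) * (codedPerm c (enc (some none)) *
            ((⁅F (some (some p)), j₀ q⁆ : S) : Perm (X × ℤ))⁻¹ *
            (codedPerm c (enc (some none)))⁻¹) := by
        rw [commutatorElement_def ⁅F (some (some p)), j₀ q⁆]
        simp only [Subgroup.coe_mul, Subgroup.coe_inv, mul_assoc, F]
      rw [e2, e1, ← map_inv, codedPerm_conj, ← map_mul, hc, ← h3 p q hq,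
        commutatorElement_def ⁅f p, α q⁆, mul_assoc, mul_assoc, mul_assoc]
      rfl
    have hfin : j₀ p = (F none)⁻¹ * ⁅⁅F (some (some p)), j₀ q⁆, F (some none)⁆ * (F none)⁻¹⁻¹ := by
      apply Subtype.ext
      rw [Subgroup.coe_mul, Subgroup.coe_mul, hval, inv_inv]
      exact hαβ p
    rw [hfin]
    exact hN.conj_mem _ hcomm _
  obtain ⟨M, hMn, hM1, hM2⟩ := exists_normal_maximal_avoiding j₀ hj₀ hN
  refine ⟨S ⧸ M, inferInstance, (QuotientGroup.mk' M).comp ψ.rangeRestrict,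
    (QuotientGroup.mk' M).comp j₀, ?_, ?_, ?_⟩
  · exact (QuotientGroup.mk'_surjective M).comp ψ.rangeRestrict_surjective
  · rw [injective_iff_map_eq_one]
    intro q hq
    exact hM1 q ((QuotientGroup.eq_one_iff _).1 hq)
  · intro N hNn hN0 q
    refine hM2 (N.comap (QuotientGroup.mk' M)) inferInstance ?_ q
    refine lt_of_le_of_ne ?_ ?_
    · intro x hx
      rw [Subgroup.mem_comap, QuotientGroup.mk'_apply, (QuotientGroup.eq_one_iff x).2 hx]
      exact N.one_mem
    · intro heq
      apply hN0
      rw [eq_bot_iff]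
      intro x hx
      obtain ⟨y, rfl⟩ := QuotientGroup.mk'_surjective M x
      have : y ∈ N.comap (QuotientGroup.mk' M) := hx
      rw [← heq] at this
      exact (QuotientGroup.eq_one_iff y).2 this

lemma exists_complement_of_sInf_ne_top {K : Type*} [Group K] {𝓕 : Set (Subgroup K)}
    (hfin : 𝓕.Finite) (hn : ∀ M ∈ 𝓕, M.Normal) (htop : sInf 𝓕 ≠ ⊤) :
    ∃ M ∈ 𝓕, ∃ L : Subgroup K, L.Normal ∧ L ⊓ M = sInf 𝓕 ∧ ¬ L ≤ M := by
  induction 𝓕, hfin using Set.Finite.induction_on with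
  | empty => exact absurd sInf_empty htop
  | @insert a s ha hs ih =>
    rw [sInf_insert] at htop ⊢
    have hns : ∀ M ∈ s, M.Normal := fun M hM => hn M (Set.mem_insert_of_mem _ hM)
    by_cases hle : sInf s ≤ a
    · rw [inf_eq_right.2 hle] at htop ⊢
      obtain ⟨M, hM, L, h1, h2, h3⟩ := ih hns htop
      exact ⟨M, Set.mem_insert_of_mem _ hM, L, h1, h2, h3⟩
    · refine ⟨a, Set.mem_insert _ _, sInf s, ?_, inf_comm _ _, hle⟩
      refine ⟨fun x hx g => ?_⟩
      rw [Subgroup.mem_sInf] at hx ⊢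
      exact fun p hp => (hns p hp).conj_mem _ (hx p hp) g

/-- The kernel of `π` precomposed with conjugation by `g`. -/
def conjKer {G T : Type*} [Group G] [Group T] {K : Subgroup G} [K.Normal] (π : K →* T) (g : G) :
    Subgroup K :=
  (π.comp (MulAut.conjNormal g : MulAut K).toMonoidHom).ker

lemma mem_conjKer {G T : Type*} [Group G] [Group T] {K : Subgroup G} [K.Normal] {π : K →* T}
    {g : G} {x : K} : x ∈ conjKer π g ↔ π (MulAut.conjNormal g x) = 1 := Iff.rfl

lemma conjKer_mul {G T : Type*} [Group G] [Group T] {K : Subgroup G} [K.Normal] (π : K →* T)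
    (k : K) (g : G) : conjKer π (k * g) = conjKer π g := by
  ext x
  rw [mem_conjKer, mem_conjKer, map_mul, MulAut.mul_apply]
  have : MulAut.conjNormal (k : G) (MulAut.conjNormal g x) = k * MulAut.conjNormal g x * k⁻¹ := by
    apply Subtype.ext; simp
  rw [this, map_mul, map_mul, map_inv]
  constructor
  · intro h
    rw [mul_inv_eq_one] at h
    exact mul_eq_left.1 h
  · intro h; rw [h]; simp

lemma finite_range_conjKer {G T : Type*} [Group G] [Group T] {K : Subgroup G} [K.Normal]
    [K.FiniteIndex] (π : K →* T) : (Set.range (conjKer π)).Finite := by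
  have : Finite (G ⧸ K) := inferInstance
  refine (Set.finite_range fun q : G ⧸ K => conjKer π q.out).subset ?_
  rintro _ ⟨g, rfl⟩
  refine ⟨(g : G ⧸ K), ?_⟩
  obtain ⟨k, hk⟩ := QuotientGroup.mk_out_eq_mul K g
  have : (g * k : G) = ((MulAut.conjNormal g k : K) : G) * g := by simp
  change conjKer π (g : G ⧸ K).out = _
  rw [hk, this, conjKer_mul]

lemma exists_embedding_of_surjective {G T Q : Type*} [Group G] [Group T] [Group Q]
    {K : Subgroup G} [K.Normal] [K.FiniteIndex] (π : K →* T) (hπ : Function.Surjective π)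
    (j : Q →* T) (hj : Function.Injective j)
    (hT : ∀ N : Subgroup T, N.Normal → N ≠ ⊥ → ∀ q, j q ∈ N) :
    ∃ (N : Subgroup G) (hN : N.Normal),
      haveI := hN
      ∃ f : Q →* G ⧸ N, Function.Injective f := by
  by_cases htop : sInf (Set.range (conjKer π)) = ⊤
  · refine ⟨⊥, inferInstance, 1, ?_⟩
    have hT1 : ∀ y : T, y = 1 := fun y => by
      obtain ⟨x, rfl⟩ := hπ y
      have : x ∈ sInf (Set.range (conjKer π)) := htop ▸ Subgroup.mem_top x
      simpa using mem_conjKer.1 ((Subgroup.mem_sInf.1 this) _ ⟨1, rfl⟩)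
    intro a b _
    exact hj ((hT1 _).trans (hT1 _).symm)
  obtain ⟨_, ⟨g, rfl⟩, L, hL, hLM, hLn⟩ := exists_complement_of_sInf_ne_top
    (finite_range_conjKer π) (by rintro _ ⟨g, rfl⟩; unfold conjKer; infer_instance) htop
  set N₀ := sInf (Set.range (conjKer π)) with hN₀
  have hmem : ∀ x : K, x ∈ N₀ ↔ ∀ g : G, π (MulAut.conjNormal g x) = 1 := fun x => by
    rw [hN₀, Subgroup.mem_sInf]
    simp only [Set.forall_mem_range, mem_conjKer]
  let πg : K →* T := π.comp (MulAut.conjNormal g : MulAut K).toMonoidHom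
  have hπg : Function.Surjective πg := hπ.comp (MulAut.conjNormal g : MulAut K).surjective
  have hj' : ∀ q, j q ∈ L.map πg := hT _ (hL.map πg hπg) fun h0 =>
    hLn fun x hx => by
      have : πg x ∈ L.map πg := Subgroup.mem_map_of_mem _ hx
      rw [h0] at this
      exact this
  choose x hxL hxj using hj'
  have hN : (N₀.map K.subtype).Normal := by
    refine ⟨?_⟩
    rintro _ ⟨y, hy, rfl⟩ h
    refine ⟨MulAut.conjNormal h y, ?_, by simp⟩
    change y ∈ N₀ at hy
    change _ ∈ N₀
    rw [hmem] at hy ⊢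
    intro g'
    rw [← MulAut.mul_apply, ← map_mul]
    exact hy _
  refine ⟨_, hN, MonoidHom.mk' (fun q => ((x q : G) : G ⧸ N₀.map K.subtype)) ?_, ?_⟩
  · intro p q
    rw [← QuotientGroup.mk_mul, QuotientGroup.eq]
    refine ⟨(x (p * q))⁻¹ * (x p * x q), ?_, by simp⟩
    change _ ∈ N₀
    rw [← hLM]
    refine ⟨L.mul_mem (L.inv_mem (hxL _)) (L.mul_mem (hxL _) (hxL _)), ?_⟩
    change πg _ = 1
    rw [map_mul, map_inv, map_mul, hxj, hxj, hxj, map_mul, inv_mul_cancel]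
  · rw [injective_iff_map_eq_one]
    intro q hq
    obtain ⟨y, hy, hyx⟩ := (QuotientGroup.eq_one_iff _).1 hq
    have hyx' : y = x q := Subtype.ext hyx
    rw [hyx'] at hy
    apply hj
    rw [map_one, ← hxj]
    exact (hmem _).1 hy g

lemma modularGroup_not_commute {m n : ℕ} (hm : m ≠ 0) (hn : n ≠ 0) :
    ¬ Commute (ModularGroup.T ^ m) ((ModularGroup.S * ModularGroup.T * ModularGroup.S⁻¹) ^ n) := by
  intro h
  have h1 : ∀ k : ℕ, ((ModularGroup.T ^ k : Matrix.SpecialLinearGroup (Fin 2) ℤ) :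
      Matrix (Fin 2) (Fin 2) ℤ) = !![1, (k : ℤ); 0, 1] := fun k => by
    have := ModularGroup.coe_T_zpow (k : ℤ)
    rwa [zpow_natCast] at this
  rw [conj_pow] at h
  have h2 := congrArg (fun g : Matrix.SpecialLinearGroup (Fin 2) ℤ =>
    (g : Matrix (Fin 2) (Fin 2) ℤ) 0 0) h.eq
  simp only [Matrix.SpecialLinearGroup.coe_mul, h1, Matrix.SpecialLinearGroup.coe_inv,
    ModularGroup.coe_S, Matrix.adjugate_fin_two_of] at h2
  simp [Matrix.mul_apply, Fin.sum_univ_two] at h2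
  omega

lemma freeGroup_fin_two_not_commute {m n : ℕ} (hm : m ≠ 0) (hn : n ≠ 0) :
    ¬ Commute (FreeGroup.of (0 : Fin 2) ^ m) (FreeGroup.of 1 ^ n) := by
  intro h
  have := h.map (FreeGroup.lift ![ModularGroup.T,
    ModularGroup.S * ModularGroup.T * ModularGroup.S⁻¹])
  simp only [map_pow, FreeGroup.lift_apply_of] at this
  exact modularGroup_not_commute hm hn this

lemma exists_surjective_freeGroup_fin_two {R : Type*} [Group R] [IsFreeGroup R] {x y : R}
    (hxy : ¬ Commute x y) : ∃ f : R →* FreeGroup (Fin 2), Function.Surjective f := by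
  classical
  obtain ⟨a, b, hab⟩ : ∃ a b : IsFreeGroup.Generators R, a ≠ b := by
    by_contra! hcon
    apply hxy
    let e := IsFreeGroup.toFreeGroup R
    have hc : ∀ z w : FreeGroup (IsFreeGroup.Generators R), Commute z w := by
      intro z w
      induction z using FreeGroup.induction_on with
      | C1 => exact Commute.one_left _
      | of a =>
        induction w using FreeGroup.induction_on with
        | C1 => exact Commute.one_right _
        | of b => rw [hcon a b]
        | inv_of b h => exact h.inv_right
        | mul z w h1 h2 => exact h1.mul_right h2
      | inv_of a h => exact h.inv_left
      | mul z w h1 h2 => exact h1.mul_left h2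
    apply e.injective
    rw [map_mul, map_mul]
    exact (hc _ _).eq
  refine ⟨(FreeGroup.lift fun c => if c = a then FreeGroup.of 0 else
    if c = b then FreeGroup.of 1 else 1).comp (IsFreeGroup.toFreeGroup R).toMonoidHom, ?_⟩
  rw [MonoidHom.coe_comp]
  refine Function.Surjective.comp ?_ (IsFreeGroup.toFreeGroup R).surjective
  rw [← MonoidHom.range_eq_top, eq_top_iff, ← FreeGroup.closure_range_of, Subgroup.closure_le]
  rintro _ ⟨i, rfl⟩
  fin_cases i
  · exact ⟨FreeGroup.of a, by simp⟩
  · exact ⟨FreeGroup.of b, by simp [hab.symm]⟩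

theorem sqUniversal_of_surjective {G : Type*} [Group G] {H : Subgroup G} [H.FiniteIndex]
    (f : H →* FreeGroup (Fin 2)) (hf : Function.Surjective f) : SQUniversal G := by
  intro Q _ _
  have hK : H.normalCore.FiniteIndex := inferInstance
  let f' : H.normalCore →* FreeGroup (Fin 2) := f.comp (Subgroup.inclusion H.normalCore_le)
  have hpow : ∀ i : Fin 2, ∃ n : ℕ, n ≠ 0 ∧ FreeGroup.of i ^ n ∈ f'.range := by
    intro i
    obtain ⟨h, hh⟩ := hf (FreeGroup.of i)
    obtain ⟨n, hn, -, hmem⟩ := Subgroup.exists_pow_mem_of_index_ne_zero hK.index_ne_zero (h : G)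
    refine ⟨n, hn.ne', ⟨⟨_, hmem⟩, ?_⟩⟩
    rw [← hh, ← map_pow]
    rfl
  obtain ⟨m, hm, hx⟩ := hpow 0
  obtain ⟨n, hn, hy⟩ := hpow 1
  obtain ⟨r, hr⟩ := exists_surjective_freeGroup_fin_two (R := f'.range)
    (x := ⟨_, hx⟩) (y := ⟨_, hy⟩)
    fun h => freeGroup_fin_two_not_commute hm hn (h.map f'.range.subtype)
  obtain ⟨T, _, π, j, hπ, hj, hT⟩ := exists_two_generated_monolithic Q
  exact exists_embedding_of_surjective ((π.comp r).comp f'.rangeRestrict)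
    ((hπ.comp hr).comp f'.rangeRestrict_surjective) j hj hT

/-- The integral matrix with rows `(a, b)` and `(c, d)` and determinant `±1`. -/
noncomputable def intGL (a b c d : ℤ) (h : IsUnit (a * d - b * c)) : GL (Fin 2) ℤ :=
  Matrix.GeneralLinearGroup.mk'' !![a, b; c, d] (by rwa [Matrix.det_fin_two_of])

@[simp] lemma coe_intGL (a b c d : ℤ) (h : IsUnit (a * d - b * c)) :
    (intGL a b c d h : Matrix (Fin 2) (Fin 2) ℤ) = !![a, b; c, d] := rfl

lemma GL_ext_fin_two {g h : GL (Fin 2) ℤ} (h00 : g 0 0 = h 0 0) (h01 : g 0 1 = h 0 1)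
    (h10 : g 1 0 = h 1 0) (h11 : g 1 1 = h 1 1) : g = h := by
  ext i j
  fin_cases i <;> fin_cases j <;> assumption

lemma GL_mul_apply_fin_two (g h : GL (Fin 2) ℤ) (i j : Fin 2) :
    (g * h) i j = g i 0 * h 0 j + g i 1 * h 1 j := by
  simp [Matrix.mul_apply, Fin.sum_univ_two]

lemma isUnit_det_fin_two (g : GL (Fin 2) ℤ) : IsUnit (g 0 0 * g 1 1 - g 0 1 * g 1 0) := by
  rw [← Matrix.det_fin_two]
  exact (Matrix.isUnit_iff_isUnit_det _).1 g.isUnit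

/-- The upper unitriangular matrix with off-diagonal entry `2`. -/
noncomputable def upperTwo : GL (Fin 2) ℤ := intGL 1 2 0 1 (by norm_num)

/-- The lower unitriangular matrix with off-diagonal entry `2`. -/
noncomputable def lowerTwo : GL (Fin 2) ℤ := intGL 1 0 2 1 (by norm_num)

lemma upperTwo_inv : upperTwo⁻¹ = intGL 1 (-2) 0 1 (by norm_num) := by
  rw [inv_eq_iff_mul_eq_one]
  apply GL_ext_fin_two <;> rw [GL_mul_apply_fin_two] <;> simp [upperTwo]

lemma lowerTwo_inv : lowerTwo⁻¹ = intGL 1 0 (-2) 1 (by norm_num) := by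
  rw [inv_eq_iff_mul_eq_one]
  apply GL_ext_fin_two <;> rw [GL_mul_apply_fin_two] <;> simp [lowerTwo]

/-- The homomorphism from the free group of rank two sending the generators to `upperTwo` and
`lowerTwo`. -/
noncomputable def sanov : FreeGroup (Fin 2) →* GL (Fin 2) ℤ := FreeGroup.lift ![upperTwo, lowerTwo]

lemma sanov_injective : Function.Injective sanov := by
  let X : Fin 2 → Set (GL (Fin 2) ℤ) :=
    ![{g | g 1 0 ^ 2 ≤ g 0 0 * g 1 0}, {g | 0 ≤ g 0 0 * g 1 0 ∧ g 0 0 * g 1 0 < g 1 0 ^ 2}]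
  let Y : Fin 2 → Set (GL (Fin 2) ℤ) :=
    ![{g | g 0 0 * g 1 0 < - g 1 0 ^ 2}, {g | - g 1 0 ^ 2 ≤ g 0 0 * g 1 0 ∧ g 0 0 * g 1 0 < 0}]
  have hne : ∀ g : GL (Fin 2) ℤ, g 0 0 ≠ 0 ∨ g 1 0 ≠ 0 := fun g => by
    by_contra! h
    have := isUnit_det_fin_two g
    rw [h.1, h.2] at this
    simp at this
  have hX0 : X 0 = {g | g 1 0 ^ 2 ≤ g 0 0 * g 1 0} := rfl
  have hX1 : X 1 = {g | 0 ≤ g 0 0 * g 1 0 ∧ g 0 0 * g 1 0 < g 1 0 ^ 2} := rfl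
  have hY0 : Y 0 = {g | g 0 0 * g 1 0 < - g 1 0 ^ 2} := rfl
  have hY1 : Y 1 = {g | - g 1 0 ^ 2 ≤ g 0 0 * g 1 0 ∧ g 0 0 * g 1 0 < 0} := rfl
  refine FreeGroup.injective_lift_of_ping_pong (α := GL (Fin 2) ℤ) ![upperTwo, lowerTwo] X Y
    ?_ ?_ ?_ ?_ ?_ ?_
  · intro i
    fin_cases i
    · exact ⟨1, by change 1 ∈ X 0; rw [hX0]; simp⟩
    · exact ⟨intGL 1 0 2 1 (by norm_num), by change _ ∈ X 1; rw [hX1]; simp⟩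
  · have : Disjoint (X 0) (X 1) := by
      rw [Set.disjoint_left]; intro g h1 h2; rw [hX0] at h1; rw [hX1] at h2
      simp only [Set.mem_ofPred_eq] at h1 h2; omega
    intro i j hij
    fin_cases i <;> fin_cases j
    · exact absurd rfl hij
    · exact this
    · exact this.symm
    · exact absurd rfl hij
  · have : Disjoint (Y 0) (Y 1) := by
      rw [Set.disjoint_left]; intro g h1 h2; rw [hY0] at h1; rw [hY1] at h2
      simp only [Set.mem_ofPred_eq] at h1 h2; omega
    intro i j hij
    fin_cases i <;> fin_cases j
    · exact absurd rfl hij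
    · exact this
    · exact this.symm
    · exact absurd rfl hij
  · intro i j
    rw [Set.disjoint_left]
    intro g h1 h2
    have h3 := sq_nonneg (g 1 0)
    fin_cases i <;> fin_cases j
    · change g ∈ X 0 at h1; change g ∈ Y 0 at h2; rw [hX0] at h1; rw [hY0] at h2
      simp only [Set.mem_ofPred_eq] at h1 h2; omega
    · change g ∈ X 0 at h1; change g ∈ Y 1 at h2; rw [hX0] at h1; rw [hY1] at h2
      simp only [Set.mem_ofPred_eq] at h1 h2; omega
    · change g ∈ X 1 at h1; change g ∈ Y 0 at h2; rw [hX1] at h1; rw [hY0] at h2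
      simp only [Set.mem_ofPred_eq] at h1 h2; omega
    · change g ∈ X 1 at h1; change g ∈ Y 1 at h2; rw [hX1] at h1; rw [hY1] at h2
      simp only [Set.mem_ofPred_eq] at h1 h2; omega
  · intro i
    rintro _ ⟨g, hg, rfl⟩
    have hg0 := hne g
    fin_cases i
    · change g ∉ Y 0 at hg
      change upperTwo * g ∈ X 0
      rw [hY0] at hg
      rw [hX0]
      simp only [Set.mem_ofPred_eq, GL_mul_apply_fin_two, upperTwo, coe_intGL] at hg ⊢
      generalize g 0 0 = x at *
      generalize g 1 0 = y at *
      simp at hg ⊢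
      nlinarith
    · change g ∉ Y 1 at hg
      change lowerTwo * g ∈ X 1
      rw [hY1] at hg
      rw [hX1]
      simp only [Set.mem_ofPred_eq, GL_mul_apply_fin_two, lowerTwo, coe_intGL] at hg ⊢
      generalize g 0 0 = x at *
      generalize g 1 0 = y at *
      simp at hg ⊢
      by_cases h : 0 ≤ x * y
      · refine ⟨by nlinarith [sq_nonneg x], ?_⟩
        rcases hg0 with h0 | h0
        · have := sq_pos_of_ne_zero h0 |>.le; have := sq_pos_of_ne_zero h0; nlinarith
        · have := sq_pos_of_ne_zero h0; nlinarith
      · have h1 : x * y < - y ^ 2 := by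
          by_contra h1; have := hg (by linarith); omega
        have h2 : 0 < x * (x + y) := by nlinarith
        refine ⟨by nlinarith, ?_⟩
        have h3 : 0 < x * (y + 2 * x) := by nlinarith
        nlinarith
  · intro i
    rintro _ ⟨g, hg, rfl⟩
    have hg0 := hne g
    fin_cases i
    · change g ∉ X 0 at hg
      change upperTwo⁻¹ * g ∈ Y 0
      rw [hX0] at hg
      rw [hY0, upperTwo_inv]
      simp only [Set.mem_ofPred_eq, GL_mul_apply_fin_two, coe_intGL] at hg ⊢
      generalize g 0 0 = x at *
      generalize g 1 0 = y at *
      simp at hg ⊢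
      nlinarith
    · change g ∉ X 1 at hg
      change lowerTwo⁻¹ * g ∈ Y 1
      rw [hX1] at hg
      rw [hY1, lowerTwo_inv]
      simp only [Set.mem_ofPred_eq, GL_mul_apply_fin_two, coe_intGL] at hg ⊢
      generalize g 0 0 = x at *
      generalize g 1 0 = y at *
      simp at hg ⊢
      by_cases h : 0 ≤ x * y
      · have h1 := hg h
        have h2 : 0 ≤ x * (x - y) := by nlinarith [sq_nonneg (x - y)]
        have hx : x ≠ 0 := by
          rintro rfl
          rcases hg0 with h0 | h0
          · exact h0 rfl
          · have := sq_pos_of_ne_zero h0; linarith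
        have := sq_pos_of_ne_zero hx
        constructor <;> nlinarith [sq_nonneg (x - y)]
      · constructor <;> nlinarith [sq_nonneg x, sq_nonneg y]

lemma mem_range_sanov (n : ℕ) : ∀ g : GL (Fin 2) ℤ, (g 0 0).natAbs + (g 1 0).natAbs ≤ n →
    g 0 0 % 4 = 1 → g 1 1 % 4 = 1 → g 0 1 % 2 = 0 → g 1 0 % 2 = 0 →
    g 0 0 * g 1 1 - g 0 1 * g 1 0 = 1 → g ∈ sanov.range := by
  have hA : upperTwo ∈ sanov.range := ⟨FreeGroup.of 0, by simp [sanov]⟩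
  have hB : lowerTwo ∈ sanov.range := ⟨FreeGroup.of 1, by simp [sanov]⟩
  induction n with
  | zero => intro g hn h0; omega
  | succ n ih =>
    intro g hn h00 h11 h01 h10 hdet
    -- each of the four elementary moves preserves the congruence conditions
    have hmv : ∀ h : GL (Fin 2) ℤ, h ∈ sanov.range →
        ((h * g) 0 0).natAbs + ((h * g) 1 0).natAbs ≤ n →
        (h * g) 0 0 % 4 = 1 → (h * g) 1 1 % 4 = 1 → (h * g) 0 1 % 2 = 0 → (h * g) 1 0 % 2 = 0 →
        (h * g) 0 0 * (h * g) 1 1 - (h * g) 0 1 * (h * g) 1 0 = 1 → g ∈ sanov.range :=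
      fun h hh h1 h2 h3 h4 h5 h6 => (sanov.range.mul_mem_cancel_left hh).1 (ih _ h1 h2 h3 h4 h5 h6)
    by_cases hc : g 1 0 = 0
    · have ha : g 0 0 = 1 := by
        rw [hc, mul_zero, sub_zero] at hdet
        rcases Int.eq_one_or_neg_one_of_mul_eq_one hdet with h | h <;> omega
      have hd : g 1 1 = 1 := by rw [hc, ha] at hdet; linarith
      have hpow : ∀ k : ℤ, (upperTwo ^ k : GL (Fin 2) ℤ) = intGL 1 (2 * k) 0 1 (by norm_num) := by
        intro k
        induction k using Int.induction_on with
        | zero => apply GL_ext_fin_two <;> simp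
        | succ k ih =>
          rw [zpow_add_one, ih]
          apply GL_ext_fin_two <;> rw [GL_mul_apply_fin_two] <;> simp [upperTwo] <;> ring
        | pred k ih =>
          rw [zpow_sub_one, ih, upperTwo_inv]
          apply GL_ext_fin_two <;> rw [GL_mul_apply_fin_two] <;> simp <;> ring
      have : g = upperTwo ^ (g 0 1 / 2) := by
        rw [hpow]
        apply GL_ext_fin_two <;> simp [ha, hc, hd]
        omega
      rw [this]
      exact sanov.range.zpow_mem hA _
    · by_cases hlt : (g 1 0).natAbs < (g 0 0).natAbs
      · by_cases hs : (g 0 0 - 2 * g 1 0).natAbs < (g 0 0).natAbs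
        · apply hmv upperTwo⁻¹ (inv_mem hA) <;>
            simp only [upperTwo_inv, GL_mul_apply_fin_two, coe_intGL] <;> simp <;>
            first | omega | linarith
        · apply hmv upperTwo hA <;>
            simp only [upperTwo, GL_mul_apply_fin_two, coe_intGL] <;> simp <;>
            first | omega | linarith
      · by_cases hs : (g 1 0 - 2 * g 0 0).natAbs < (g 1 0).natAbs
        · apply hmv lowerTwo⁻¹ (inv_mem hB) <;>
            simp only [lowerTwo_inv, GL_mul_apply_fin_two, coe_intGL] <;> simp <;>
            first | omega | linarith
        · apply hmv lowerTwo hB <;>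
            simp only [lowerTwo, GL_mul_apply_fin_two, coe_intGL] <;> simp <;>
            first | omega | linarith

lemma finiteIndex_range_sanov : sanov.range.FiniteIndex := by
  let r : GL (Fin 2) ℤ →* GL (Fin 2) (ZMod 4) :=
    Matrix.GeneralLinearGroup.map (Int.castRingHom (ZMod 4))
  have : r.ker.FiniteIndex := Subgroup.finiteIndex_ker r
  refine Subgroup.finiteIndex_of_le (H := r.ker) fun g hg => ?_
  have he : ∀ i j, ((g i j : ℤ) : ZMod 4) = (1 : Matrix (Fin 2) (Fin 2) (ZMod 4)) i j :=
      fun i j => by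
    have : r g = 1 := hg
    have := congrArg (fun M : GL (Fin 2) (ZMod 4) => M i j) this
    simpa [r] using this
  have h1 : ∀ z : ℤ, (z : ZMod 4) = 1 → z % 4 = 1 := fun z hz => by
    have : (z : ZMod 4) = ((1 : ℤ) : ZMod 4) := by simpa using hz
    have := (ZMod.intCast_eq_intCast_iff _ _ 4).1 this
    simpa [Int.ModEq] using this
  have h0 : ∀ z : ℤ, (z : ZMod 4) = 0 → z % 4 = 0 := fun z hz => by
    have := (ZMod.intCast_zmod_eq_zero_iff_dvd z 4).1 hz
    exact Int.emod_eq_zero_of_dvd this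
  have h00 := h1 _ (he 0 0)
  have h11 := h1 _ (he 1 1)
  have h01 := h0 _ (he 0 1)
  have h10 := h0 _ (he 1 0)
  refine mem_range_sanov _ g le_rfl h00 h11 (by omega) (by omega) ?_
  rcases Int.isUnit_iff.1 (isUnit_det_fin_two g) with h | h
  · exact h
  · exfalso
    have e : (g 0 0 * g 1 1 - g 0 1 * g 1 0) % 4 = 1 := by
      rw [Int.sub_emod, Int.mul_emod, Int.mul_emod (g 0 1), h00, h11, h01, h10]; norm_num
    rw [h] at e
    norm_num at e

lemma pgl_mk_sanov_injective :
    Function.Injective ((ProjGenLinGroup.mk (n := Fin 2) (R := ℤ)).comp sanov) := by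
  rw [injective_iff_map_eq_one]
  intro w hw
  rw [MonoidHom.comp_apply, ProjGenLinGroup.mk_eq_one,
    Matrix.GeneralLinearGroup.center_eq_range_scalar] at hw
  obtain ⟨u, hu⟩ := hw
  have : sanov (w ^ 2) = 1 := by
    rw [map_pow, ← hu, ← map_pow, Int.units_sq, map_one]
  rw [← map_one sanov] at this
  exact sq_eq_one.1 (sanov_injective this)

theorem sqUniversal_of_hom_pgl {G : Type*} [Group G] {H : Subgroup G} [H.FiniteIndex]
    (θ : H →* ProjGenLinGroup (Fin 2) ℤ) (hA : ProjGenLinGroup.mk upperTwo ∈ θ.range)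
    (hB : ProjGenLinGroup.mk lowerTwo ∈ θ.range) : SQUniversal G := by
  set ψ := (ProjGenLinGroup.mk (n := Fin 2) (R := ℤ)).comp sanov with hψ
  have hfin : ψ.range.FiniteIndex := by
    rw [hψ, MonoidHom.range_comp]
    have := finiteIndex_range_sanov
    exact ⟨ne_zero_of_dvd_ne_zero this.index_ne_zero
      (sanov.range.index_map_dvd ProjGenLinGroup.mk_surjective)⟩
  have hle : ψ.range ≤ θ.range := by
    rintro _ ⟨w, rfl⟩
    induction w using FreeGroup.induction_on with
    | C1 => simp
    | of i =>
      fin_cases i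
      · simpa [hψ, sanov] using hA
      · simpa [hψ, sanov] using hB
    | inv_of i h => rw [map_inv]; exact inv_mem h
    | mul x y hx hy => rw [map_mul]; exact mul_mem hx hy
  let K : Subgroup H := ψ.range.comap θ
  have hK : K.FiniteIndex := ⟨by
    rw [Subgroup.index_comap]
    exact (Subgroup.isFiniteRelIndex_of_finiteIndex (H := ψ.range) (K := θ.range)).relIndex_ne_zero⟩
  have hKG : (K.map H.subtype).FiniteIndex := ⟨by
    rw [Subgroup.index_map_subtype]
    exact mul_ne_zero hK.index_ne_zero Subgroup.FiniteIndex.index_ne_zero⟩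
  let e := K.equivMapOfInjective H.subtype H.subtype_injective
  let e2 := MonoidHom.ofInjective pgl_mk_sanov_injective
  let θ' : K →* ψ.range := (θ.comp K.subtype).codRestrict ψ.range fun k => k.2
  have hθ' : Function.Surjective θ' := by
    rintro ⟨y, hy⟩
    obtain ⟨h, rfl⟩ := hle hy
    exact ⟨⟨h, hy⟩, rfl⟩
  refine sqUniversal_of_surjective (H := K.map H.subtype)
    (e2.symm.toMonoidHom.comp (θ'.comp e.symm.toMonoidHom)) ?_
  exact e2.symm.surjective.comp (hθ'.comp e.symm.surjective)

namespace RACG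

variable {V : Type*} {Γ : SimpleGraph V}

/-- The generator of the right-angled Coxeter group attached to a vertex. -/
def of (Γ : SimpleGraph V) (v : V) : RACG Γ := PresentedGroup.of v

lemma of_mul_self (v : V) : of Γ v * of Γ v = 1 :=
  PresentedGroup.one_of_mem (rels := racgRels Γ) (Or.inl ⟨v, rfl⟩)

lemma of_inv (v : V) : (of Γ v)⁻¹ = of Γ v := inv_eq_of_mul_eq_one_left (of_mul_self v)

lemma commute_of_adj {u v : V} (h : Γ.Adj u v) : Commute (of Γ u) (of Γ v) := by
  have h1 : (of Γ u * of Γ v) ^ 2 = 1 :=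
    PresentedGroup.one_of_mem (rels := racgRels Γ) (Or.inr ⟨u, v, h, rfl⟩)
  rw [sq, mul_eq_one_iff_eq_inv, mul_inv_rev, of_inv, of_inv] at h1
  exact h1

/-- The universal property of the right-angled Coxeter group. -/
def lift {G : Type*} [Group G] (f : V → G) (hsq : ∀ v, f v * f v = 1)
    (hadj : ∀ u v, Γ.Adj u v → Commute (f u) (f v)) : RACG Γ →* G :=
  PresentedGroup.toGroup (rels := racgRels Γ) (f := f) (by
    rintro r (⟨v, rfl⟩ | ⟨u, v, h, rfl⟩)
    · simpa using hsq v
    · simp only [map_pow, map_mul, FreeGroup.lift_apply_of]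
      rw [(hadj u v h).mul_pow, sq, sq, hsq, hsq, one_mul])

@[simp] lemma lift_of {G : Type*} [Group G] (f : V → G) (hsq : ∀ v, f v * f v = 1)
    (hadj : ∀ u v, Γ.Adj u v → Commute (f u) (f v)) (v : V) :
    lift f hsq hadj (of Γ v) = f v :=
  PresentedGroup.toGroup.of _

lemma induction_left {p : RACG Γ → Prop} (one : p 1) (mul : ∀ v y, p y → p (of Γ v * y))
    (y : RACG Γ) : p y := by
  have hy : y ∈ Subgroup.closure (Set.range (of Γ)) := by
    rw [show Subgroup.closure (Set.range (of Γ)) = ⊤ from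
      PresentedGroup.closure_range_of (racgRels Γ)]
    trivial
  induction hy using Subgroup.closure_induction_left with
  | one => exact one
  | mul_left x hx y hy ih => obtain ⟨v, rfl⟩ := hx; exact mul v y ih
  | inv_mul_cancel x hx y hy ih => obtain ⟨v, rfl⟩ := hx; rw [of_inv]; exact mul v y ih

lemma hom_ext {G : Type*} [Group G] {f g : RACG Γ →* G} (h : ∀ v, f (of Γ v) = g (of Γ v)) :
    f = g := by
  ext y
  induction y using induction_left with
  | one => simp
  | mul v y ih => rw [map_mul, map_mul, h, ih]

instance [Finite V] : Finite (RACG Γ →* ℤˣ) :=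
  Finite.of_injective (fun χ (v : V) => χ (of Γ v)) fun _ _ h => hom_ext fun v => congrFun h v

end RACG

/-- The action of the automorphism group on sign characters. -/
def signCharacterPerm (W : Type*) [Group W] : MulAut W →* Perm (W →* ℤˣ) where
  toFun φ :=
    { toFun := fun χ => χ.comp (φ⁻¹ : MulAut W).toMonoidHom
      invFun := fun χ => χ.comp φ.toMonoidHom
      left_inv := fun χ => by ext x; simp
      right_inv := fun χ => by ext x; simp }
  map_one' := by ext; rfl
  map_mul' φ ψ := by ext χ x; simp

/-- The automorphisms fixing every sign character. -/
def signStabilizer (W : Type*) [Group W] : Subgroup (MulAut W) := (signCharacterPerm W).ker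

lemma mem_signStabilizer {W : Type*} [Group W] {φ : MulAut W} :
    φ ∈ signStabilizer W ↔ ∀ (χ : W →* ℤˣ) (x : W), χ (φ x) = χ x := by
  rw [signStabilizer, MonoidHom.mem_ker]
  constructor
  · intro h χ x
    have := congrArg (fun f : Perm (W →* ℤˣ) => f χ (φ x)) h
    simpa [signCharacterPerm] using this.symm
  · intro h
    ext χ x
    have := h χ (φ⁻¹ x)
    simp only [MulAut.apply_inv_self] at this
    simpa [signCharacterPerm] using this.symm ▸ rfl

lemma conj_mem_signStabilizer {W : Type*} [Group W] (y : W) : MulAut.conj y ∈ signStabilizer W := by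
  rw [mem_signStabilizer]
  intro χ x
  rw [MulAut.conj_apply, map_mul, map_mul, map_inv, mul_comm (χ y), mul_inv_cancel_right]

instance {W : Type*} [Group W] [Finite (W →* ℤˣ)] : (signStabilizer W).FiniteIndex :=
  Subgroup.finiteIndex_ker _

/-- A family of pairwise non-adjacent vertices, one of which is distinguished. -/
structure PointedCoclique {V : Type*} (Γ : SimpleGraph V) (ι : Type*) where
  /-- The vertices of the family; the distinguished one is the value at `none`. -/
  vertex : Option ι → V
  injective : Function.Injective vertex
  not_adj : ∀ o o', ¬ Γ.Adj (vertex o) (vertex o')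

namespace PointedCoclique

variable {V ι : Type*} {Γ : SimpleGraph V} (C : PointedCoclique Γ ι)

open Classical in
/-- The sign character that is nontrivial exactly on the vertices of the family. -/
noncomputable def sgn : RACG Γ →* ℤˣ :=
  RACG.lift (fun v => if ∃ o, C.vertex o = v then -1 else 1)
    (fun _ => Int.units_mul_self _) (fun _ _ _ => Commute.all _ _)

lemma sgn_vertex (o : Option ι) : C.sgn (RACG.of Γ (C.vertex o)) = -1 := by
  rw [sgn, RACG.lift_of, if_pos ⟨o, rfl⟩]

lemma sgn_of_forall_ne {v : V} (h : ∀ o, C.vertex o ≠ v) : C.sgn (RACG.of Γ v) = 1 := by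
  rw [sgn, RACG.lift_of, if_neg (by simpa using h)]

variable [DecidableEq ι]

/-- Twice the centre of the point reflection of `ι → ℤ` attached to an index. -/
def center : Option ι → ι → ℤ
  | none => 0
  | some i => Pi.single i 1

open Classical in
/-- The point reflection attached to a vertex of the family; other vertices act trivially. -/
noncomputable def label (v : V) : Perm (ι → ℤ) :=
  if h : ∃ o, C.vertex o = v then Equiv.subLeft (center h.choose) else 1

lemma label_vertex (o : Option ι) : C.label (C.vertex o) = Equiv.subLeft (center o) := by
  have h : ∃ o', C.vertex o' = C.vertex o := ⟨o, rfl⟩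
  rw [label, dif_pos h, C.injective h.choose_spec]

lemma label_of_forall_ne {v : V} (h : ∀ o, C.vertex o ≠ v) : C.label v = 1 := by
  rw [label, dif_neg (by simpa using h)]

/-- The action of the Coxeter group on `ι → ℤ` by point reflections and translations. -/
noncomputable def rep : RACG Γ →* Perm (ι → ℤ) :=
  RACG.lift C.label
    (fun v => by
      by_cases h : ∃ o, C.vertex o = v
      · obtain ⟨o, rfl⟩ := h
        rw [label_vertex]; ext x; simp
      · rw [C.label_of_forall_ne (by simpa using h), one_mul])
    (fun u v huv => by
      by_cases h : ∃ o, C.vertex o = u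
      · by_cases h' : ∃ o', C.vertex o' = v
        · obtain ⟨o, rfl⟩ := h
          obtain ⟨o', rfl⟩ := h'
          exact absurd huv (C.not_adj o o')
        · rw [C.label_of_forall_ne (v := v) (by simpa using h')]; exact Commute.one_right _
      · rw [C.label_of_forall_ne (by simpa using h)]; exact Commute.one_left _)

/-- The translation part of an element: the image of the origin. -/
noncomputable def trans (y : RACG Γ) : ι → ℤ := C.rep y 0

lemma trans_vertex (o : Option ι) : C.trans (RACG.of Γ (C.vertex o)) = center o := by
  rw [trans, rep, RACG.lift_of, label_vertex]; simp

lemma trans_of_forall_ne {v : V} (h : ∀ o, C.vertex o ≠ v) : C.trans (RACG.of Γ v) = 0 := by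
  rw [trans, rep, RACG.lift_of, C.label_of_forall_ne h]; rfl

@[simp] lemma trans_one : C.trans 1 = 0 := by simp [trans]

lemma rep_apply (y : RACG Γ) (x : ι → ℤ) : C.rep y x = (C.sgn y : ℤ) • x + C.trans y := by
  induction y using RACG.induction_left generalizing x with
  | one => simp
  | mul v y ih =>
    rw [trans, map_mul, map_mul, Perm.mul_apply, Perm.mul_apply, ih, ih 0]
    by_cases h : ∃ o, C.vertex o = v
    · obtain ⟨o, rfl⟩ := h
      rw [sgn_vertex, rep, RACG.lift_of, label_vertex]
      simp
      abel
    · have h' : ∀ o, C.vertex o ≠ v := by simpa using h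
      rw [C.sgn_of_forall_ne h', rep, RACG.lift_of, C.label_of_forall_ne h']
      simp

lemma trans_mul (y z : RACG Γ) : C.trans (y * z) = (C.sgn y : ℤ) • C.trans z + C.trans y := by
  rw [trans, map_mul, Perm.mul_apply, rep_apply]
  rfl

lemma trans_eq_zero_of_mul_self {y : RACG Γ} (hy : y * y = 1) (hs : C.sgn y = 1) :
    C.trans y = 0 := by
  have h := C.trans_mul y y
  rw [hy, hs, trans_one] at h
  funext i
  have := congrFun h i
  simp at this
  simp; omega

/-- The matrix recording the effect of an automorphism on translation parts. -/
noncomputable def linearPart (φ : MulAut (RACG Γ)) : Matrix ι ι ℤ := fun i j =>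
  C.trans (φ (RACG.of Γ (C.vertex (some j)))) i - C.trans (φ (RACG.of Γ (C.vertex none))) i

lemma linearPart_apply (φ : MulAut (RACG Γ)) (hφ : φ ∈ signStabilizer (RACG Γ)) (i j : ι) :
    C.linearPart φ i j =
      C.trans (φ (RACG.of Γ (C.vertex (some j)) * RACG.of Γ (C.vertex none))) i := by
  rw [map_mul, trans_mul, mem_signStabilizer.1 hφ, sgn_vertex, linearPart]
  simp
  ring

variable [Fintype ι]

lemma two_smul_trans_apply {φ : MulAut (RACG Γ)} (hφ : φ ∈ signStabilizer (RACG Γ))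
    (y : RACG Γ) :
    (2 : ℤ) • C.trans (φ y) = (2 : ℤ) • (C.linearPart φ).mulVec (C.trans y) +
      (1 - C.sgn y : ℤ) • C.trans (φ (RACG.of Γ (C.vertex none))) := by
  have hsgn := mem_signStabilizer.1 hφ C.sgn
  induction y using RACG.induction_left with
  | one => simp
  | mul v y ih =>
    rw [map_mul, trans_mul, trans_mul, map_mul, hsgn, smul_add, smul_comm, ih,
      Matrix.mulVec_add, Matrix.mulVec_smul]
    by_cases h : ∃ o, C.vertex o = v
    · obtain ⟨o, rfl⟩ := h
      have key : C.trans (φ (RACG.of Γ (C.vertex o))) = (C.linearPart φ).mulVec (center o) +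
          C.trans (φ (RACG.of Γ (C.vertex none))) := by
        cases o with
        | none => simp [center]
        | some i => ext j; simp [center, linearPart]
      rw [sgn_vertex, key, trans_vertex]
      ext i
      simp
      ring
    · have h' : ∀ o, C.vertex o ≠ v := by simpa using h
      have hz : C.trans (φ (RACG.of Γ v)) = 0 := by
        apply C.trans_eq_zero_of_mul_self
        · rw [← map_mul, RACG.of_mul_self, map_one]
        · rw [hsgn, C.sgn_of_forall_ne h']
      rw [hz, C.sgn_of_forall_ne h', C.trans_of_forall_ne h']
      simp

lemma trans_apply_of_sgn_eq_one {φ : MulAut (RACG Γ)} (hφ : φ ∈ signStabilizer (RACG Γ))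
    {y : RACG Γ} (hy : C.sgn y = 1) : C.trans (φ y) = (C.linearPart φ).mulVec (C.trans y) := by
  have := C.two_smul_trans_apply hφ y
  rw [hy] at this
  funext i
  simpa using congrFun this i

/-- The linear part as a monoid homomorphism on the sign stabilizer. -/
noncomputable def linearPartHom : signStabilizer (RACG Γ) →* Matrix ι ι ℤ where
  toFun φ := C.linearPart φ
  map_one' := by
    ext i j
    simp [linearPart, trans_vertex, center, Matrix.one_apply, Pi.single_apply]
  map_mul' φ ψ := by
    have hs : ∀ j, C.sgn (RACG.of Γ (C.vertex (some j)) * RACG.of Γ (C.vertex none)) = 1 :=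
      fun j => by rw [map_mul, sgn_vertex, sgn_vertex]; rfl
    ext i j
    rw [C.linearPart_apply _ (φ * ψ).2, Subgroup.coe_mul, MulAut.mul_apply,
      C.trans_apply_of_sgn_eq_one φ.2 (by rw [mem_signStabilizer.1 ψ.2, hs]), Matrix.mul_apply,
      Matrix.mulVec, dotProduct]
    refine Finset.sum_congr rfl fun k _ => ?_
    rw [← C.linearPart_apply _ ψ.2]

end PointedCoclique

namespace RACG

variable {V : Type*} {Γ : SimpleGraph V}

open Classical in
/-- The endomorphism conjugating the generator `a` by the generator `b`, where every neighbour of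
`a` is a neighbour of `b`. -/
noncomputable def partialConjHom {a b : V} (h : ∀ x, Γ.Adj a x → Γ.Adj b x) : RACG Γ →* RACG Γ :=
  lift (fun x => if x = a then of Γ b * of Γ a * of Γ b else of Γ x)
    (fun x => by
      split_ifs
      · calc of Γ b * of Γ a * of Γ b * (of Γ b * of Γ a * of Γ b)
            = of Γ b * of Γ a * (of Γ b * of Γ b) * of Γ a * of Γ b := by group
          _ = of Γ b * (of Γ a * of Γ a) * of Γ b := by rw [of_mul_self]; group
          _ = 1 := by rw [of_mul_self, mul_one, of_mul_self]
      · exact of_mul_self x)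
    (fun x y hxy => by
      split_ifs with hx hy hy
      · exact Commute.refl _
      · subst hx
        have := commute_of_adj (h y hxy)
        exact (this.mul_left (commute_of_adj hxy)).mul_left this
      · subst hy
        have := (commute_of_adj (h x hxy.symm)).symm
        exact (this.mul_right (commute_of_adj hxy)).mul_right this
      · exact commute_of_adj hxy)

lemma partialConjHom_self {a b : V} (h : ∀ x, Γ.Adj a x → Γ.Adj b x) :
    partialConjHom h (of Γ a) = of Γ b * of Γ a * of Γ b := by
  rw [partialConjHom, lift_of, if_pos rfl]

lemma partialConjHom_of_ne {a b x : V} (h : ∀ x, Γ.Adj a x → Γ.Adj b x) (hx : x ≠ a) :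
    partialConjHom h (of Γ x) = of Γ x := by
  rw [partialConjHom, lift_of, if_neg hx]

lemma partialConjHom_comp {a b : V} (hab : b ≠ a) (h : ∀ x, Γ.Adj a x → Γ.Adj b x) :
    (partialConjHom h).comp (partialConjHom h) = MonoidHom.id _ := by
  refine hom_ext fun x => ?_
  rw [MonoidHom.comp_apply, MonoidHom.id_apply]
  by_cases hx : x = a
  · subst hx
    rw [partialConjHom_self, map_mul, map_mul, partialConjHom_self, partialConjHom_of_ne h hab]
    calc of Γ b * (of Γ b * of Γ x * of Γ b) * of Γ b
        = of Γ b * of Γ b * of Γ x * (of Γ b * of Γ b) := by group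
      _ = of Γ x := by rw [of_mul_self, one_mul, mul_one]
  · rw [partialConjHom_of_ne h hx, partialConjHom_of_ne h hx]

/-- The automorphism conjugating the generator `a` by the generator `b`. -/
noncomputable def partialConj {a b : V} (hab : b ≠ a) (h : ∀ x, Γ.Adj a x → Γ.Adj b x) :
    MulAut (RACG Γ) :=
  MonoidHom.toMulEquiv _ _ (partialConjHom_comp hab h) (partialConjHom_comp hab h)

lemma partialConj_self {a b : V} (hab : b ≠ a) (h : ∀ x, Γ.Adj a x → Γ.Adj b x) :
    partialConj hab h (of Γ a) = of Γ b * of Γ a * of Γ b :=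
  partialConjHom_self h

lemma partialConj_of_ne {a b x : V} (hab : b ≠ a) (h : ∀ x, Γ.Adj a x → Γ.Adj b x) (hx : x ≠ a) :
    partialConj hab h (of Γ x) = of Γ x :=
  partialConjHom_of_ne h hx

lemma partialConj_mem_signStabilizer {a b : V} (hab : b ≠ a) (h : ∀ x, Γ.Adj a x → Γ.Adj b x) :
    partialConj hab h ∈ signStabilizer (RACG Γ) := by
  rw [mem_signStabilizer]
  intro χ x
  have : χ.comp (partialConj hab h).toMonoidHom = χ := by
    refine hom_ext fun y => ?_
    rw [MonoidHom.comp_apply]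
    change χ (partialConj hab h (of Γ y)) = _
    by_cases hy : y = a
    · subst hy
      rw [partialConj_self, map_mul, map_mul, mul_right_comm, Int.units_mul_self, one_mul]
    · rw [partialConj_of_ne hab h hy]
  exact DFunLike.congr_fun this x

end RACG

namespace PointedCoclique

variable {V : Type*} {Γ : SimpleGraph V}

lemma trans_conj {ι : Type*} [DecidableEq ι] (C : PointedCoclique Γ ι) (o o' : Option ι) :
    C.trans (RACG.of Γ (C.vertex o) * RACG.of Γ (C.vertex o') * RACG.of Γ (C.vertex o)) =
      2 • center o - center o' := by
  rw [trans_mul, trans_mul, map_mul]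
  simp only [sgn_vertex, trans_vertex]
  ext i
  simp
  ring

/-- The projective class of the linear part. -/
noncomputable def pglHom (C : PointedCoclique Γ (Fin 2)) :
    signStabilizer (RACG Γ) →* ProjGenLinGroup (Fin 2) ℤ :=
  (ProjGenLinGroup.mk (n := Fin 2) (R := ℤ)).comp C.linearPartHom.toHomUnits

lemma linearPart_partialConj {ι : Type*} [DecidableEq ι] (C : PointedCoclique Γ ι) {i : ι}
    {o : Option ι} (hab : C.vertex o ≠ C.vertex (some i))
    (h : ∀ x, Γ.Adj (C.vertex (some i)) x → Γ.Adj (C.vertex o) x) (k j : ι) :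
    C.linearPart (RACG.partialConj hab h) k j = if j = i then 2 * center o k -
      (Pi.single i 1 : ι → ℤ) k else (Pi.single j 1 : ι → ℤ) k := by
  rw [linearPart, RACG.partialConj_of_ne (x := C.vertex none) hab h
    (fun h => by simpa using C.injective h)]
  split_ifs with hj
  · subst hj
    rw [RACG.partialConj_self, trans_conj, trans_vertex]
    simp [center]
  · rw [RACG.partialConj_of_ne hab h (fun h => hj (by simpa using C.injective h)), trans_vertex,
      trans_vertex]
    simp [center]

end PointedCoclique

theorem sqUniversal_of_coclique {V : Type*} [Finite V] {Γ : SimpleGraph V}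
    (C : PointedCoclique Γ (Fin 2))
    (h : ∀ o o' x, Γ.Adj (C.vertex o) x → Γ.Adj (C.vertex o') x) :
    SQUniversal (MulAut (RACG Γ)) := by
  have hne : ∀ {o o'}, o ≠ o' → C.vertex o ≠ C.vertex o' := fun h => C.injective.ne h
  let χ (o : Option (Fin 2)) (i : Fin 2) (ho : o ≠ some i) : signStabilizer (RACG Γ) :=
    ⟨RACG.partialConj (hne ho) (h _ _), RACG.partialConj_mem_signStabilizer _ _⟩
  have hχ : ∀ o i ho k j, (C.linearPartHom.toHomUnits (χ o i ho) : Matrix (Fin 2) (Fin 2) ℤ) k j =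
      if j = i then 2 * PointedCoclique.center o k -
      (Pi.single i 1 : Fin 2 → ℤ) k else (Pi.single j 1 : Fin 2 → ℤ) k := fun o i ho k j =>
    C.linearPart_partialConj (hne ho) (h _ _) k j
  refine sqUniversal_of_hom_pgl C.pglHom
    ⟨χ none 1 (by simp) * χ (some 0) 1 (by simp), ?_⟩
    ⟨χ none 0 (by simp) * χ (some 1) 0 (by simp), ?_⟩
  all_goals
    rw [PointedCoclique.pglHom, MonoidHom.comp_apply, map_mul]
    congr 1
    apply GL_ext_fin_two <;> rw [GL_mul_apply_fin_two] <;> simp only [hχ] <;>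
    simp [upperTwo, lowerTwo, PointedCoclique.center]

namespace RACG

variable {V : Type*} {Γ : SimpleGraph V}

open Classical in
/-- The endomorphism killing the generators in `S`. -/
noncomputable def kill (Γ : SimpleGraph V) (S : Set V) : RACG Γ →* RACG Γ :=
  lift (fun x => if x ∈ S then 1 else of Γ x)
    (fun x => by split_ifs <;> simp [of_mul_self])
    (fun x y hxy => by
      split_ifs
      · exact Commute.one_left _
      · exact Commute.one_left _
      · exact Commute.one_right _
      · exact commute_of_adj hxy)

lemma kill_of_mem {S : Set V} {x : V} (hx : x ∈ S) : kill Γ S (of Γ x) = 1 := by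
  rw [kill, lift_of, if_pos hx]

lemma kill_of_notMem {S : Set V} {x : V} (hx : x ∉ S) : kill Γ S (of Γ x) = of Γ x := by
  rw [kill, lift_of, if_neg hx]

lemma kill_kill (S T : Set V) (y : RACG Γ) : kill Γ S (kill Γ T y) = kill Γ (S ∪ T) y := by
  rw [← MonoidHom.comp_apply]
  congr 1
  refine hom_ext fun x => ?_
  rw [MonoidHom.comp_apply]
  by_cases hT : x ∈ T
  · rw [kill_of_mem hT, map_one, kill_of_mem (show x ∈ S ∪ T from Or.inr hT)]
  · rw [kill_of_notMem hT]
    by_cases hS : x ∈ S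
    · rw [kill_of_mem hS, kill_of_mem (show x ∈ S ∪ T from Or.inl hS)]
    · rw [kill_of_notMem hS, kill_of_notMem (by simp [hS, hT])]

lemma kill_univ (y : RACG Γ) : kill Γ Set.univ y = 1 := by
  induction y using induction_left with
  | one => simp
  | mul v y ih => rw [map_mul, ih, kill_of_mem (Set.mem_univ v), one_mul]

lemma eq_one_of_forall_kill_singleton [Fintype V] {z : RACG Γ} (h : ∀ v, kill Γ {v} z = z) :
    z = 1 := by
  have key : ∀ s : Finset V, kill Γ s z = z := by
    classical
    intro s
    induction s using Finset.induction_on with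
    | empty =>
      have : kill Γ ((∅ : Finset V) : Set V) = MonoidHom.id _ :=
        hom_ext fun x => by rw [kill_of_notMem (by simp)]; rfl
      rw [this]; rfl
    | insert v s _ ih => rw [Finset.coe_insert, Set.insert_eq, ← kill_kill, ih, h]
  rw [← key Finset.univ, Finset.coe_univ, kill_univ]

lemma kill_compl_mul_kill {S : Set V} (hS : ∀ x ∈ S, ∀ y ∉ S, Γ.Adj x y) (y : RACG Γ) :
    kill Γ Sᶜ y * kill Γ S y = y := by
  have hcomm : ∀ x ∉ S, ∀ y : RACG Γ, Commute (of Γ x) (kill Γ Sᶜ y) := by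
    intro x hx y
    induction y using induction_left with
    | one => simp
    | mul v y ih =>
      rw [map_mul]
      refine Commute.mul_right ?_ ih
      by_cases hv : v ∈ S
      · rw [kill_of_notMem (by simpa using hv)]
        exact commute_of_adj (hS v hv x hx).symm
      · rw [kill_of_mem hv]; exact Commute.one_right _
  induction y using induction_left with
  | one => simp
  | mul x y ih =>
    rw [map_mul, map_mul]
    by_cases hx : x ∈ S
    · rw [kill_of_mem hx, kill_of_notMem (by simpa using hx), one_mul, mul_assoc, ih]
    · rw [kill_of_notMem hx, kill_of_mem (show x ∈ Sᶜ from hx), one_mul, ← mul_assoc,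
        ← (hcomm x hx y).eq, mul_assoc, ih]

lemma kill_singleton_eq_self {S : Set V} (hS : ∀ x ∈ S, ∀ y ∉ S, Γ.Adj x y) {v : V} (hv : v ∈ S)
    {z : RACG Γ} (hz : kill Γ Sᶜ z = 1) : kill Γ {v} z = z := by
  have h := kill_compl_mul_kill hS z
  rw [hz, one_mul] at h
  rw [← h, kill_kill, Set.union_eq_self_of_subset_left (by simpa using hv)]

end RACG

namespace PointedCoclique

variable {V ι : Type*} {Γ : SimpleGraph V}

lemma kill_vertex_compl_range (C : PointedCoclique Γ ι) (o : Option ι) :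
    RACG.kill Γ (Set.range C.vertex)ᶜ (RACG.of Γ (C.vertex o)) = RACG.of Γ (C.vertex o) :=
  RACG.kill_of_notMem (by simp)

lemma kill_compl_range_of_forall_ne (C : PointedCoclique Γ ι) {v : V} (h : ∀ o, C.vertex o ≠ v) :
    RACG.kill Γ (Set.range C.vertex)ᶜ (RACG.of Γ v) = 1 :=
  RACG.kill_of_mem (by simpa using h)

lemma kill_eq_of_isEmpty [IsEmpty ι] (C : PointedCoclique Γ ι) (y : RACG Γ) :
    RACG.kill Γ (Set.range C.vertex)ᶜ y =
      if C.sgn y = 1 then 1 else RACG.of Γ (C.vertex none) := by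
  induction y using RACG.induction_left with
  | one => simp
  | mul v y ih =>
    rw [map_mul, map_mul, ih]
    by_cases h : ∃ o, C.vertex o = v
    · obtain ⟨o, rfl⟩ := h
      cases o with
      | none =>
        rw [kill_vertex_compl_range, sgn_vertex]
        rcases Int.units_eq_one_or (C.sgn y) with h | h <;> simp [h, RACG.of_mul_self]
      | some i => exact isEmptyElim i
    · have h' : ∀ o, C.vertex o ≠ v := by simpa using h
      rw [C.kill_compl_range_of_forall_ne h', C.sgn_of_forall_ne h', one_mul, one_mul]

lemma kill_eq_of_unit (C : PointedCoclique Γ Unit) (y : RACG Γ) :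
    RACG.kill Γ (Set.range C.vertex)ᶜ y =
      (RACG.of Γ (C.vertex (some ())) * RACG.of Γ (C.vertex none)) ^ (C.trans y ()) *
      if C.sgn y = 1 then 1 else RACG.of Γ (C.vertex none) := by
  induction y using RACG.induction_left with
  | one => simp
  | mul v y ih =>
    rw [map_mul, map_mul, ih, trans_mul]
    have hneg : ∀ n : ℤ, RACG.of Γ (C.vertex none) * (RACG.of Γ (C.vertex (some ())) *
        RACG.of Γ (C.vertex none)) ^ n = (RACG.of Γ (C.vertex (some ())) *
        RACG.of Γ (C.vertex none)) ^ (-n) * RACG.of Γ (C.vertex none) := fun n => by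
      rw [← mul_inv_eq_iff_eq_mul, ← conj_zpow, zpow_neg, ← inv_zpow]
      congr 1
      rw [mul_inv_rev, RACG.of_inv, RACG.of_inv, mul_assoc, mul_assoc, RACG.of_mul_self, mul_one]
    by_cases h : ∃ o, C.vertex o = v
    · obtain ⟨o, rfl⟩ := h
      cases o with
      | none =>
        rw [kill_vertex_compl_range, sgn_vertex, trans_vertex, ← mul_assoc, hneg]
        rcases Int.units_eq_one_or (C.sgn y) with h | h <;>
          simp [h, RACG.of_mul_self, center, mul_assoc]
      | some i =>
        have hsome : RACG.of Γ (C.vertex (some ())) = (RACG.of Γ (C.vertex (some ())) *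
          RACG.of Γ (C.vertex none)) * RACG.of Γ (C.vertex none) := by
          rw [mul_assoc, RACG.of_mul_self, mul_one]
        rw [kill_vertex_compl_range, sgn_vertex, trans_vertex]
        nth_rewrite 1 [hsome]
        rw [mul_assoc, ← mul_assoc (RACG.of Γ (C.vertex none)), hneg, ← mul_assoc, ← mul_assoc,
          ← zpow_one_add]
        rcases Int.units_eq_one_or (C.sgn y) with h | h <;>
          simp [h, RACG.of_mul_self, center, mul_assoc, add_comm]
    · have h' : ∀ o, C.vertex o ≠ v := by simpa using h
      rw [C.kill_compl_range_of_forall_ne h', C.sgn_of_forall_ne h', one_mul, one_mul,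
        C.trans_of_forall_ne h']
      simp

lemma linearPart_sq_of_unit (C : PointedCoclique Γ Unit) (φ : signStabilizer (RACG Γ)) :
    C.linearPart (φ * φ : MulAut (RACG Γ)) = 1 := by
  have h1 : C.linearPart (φ * φ : MulAut (RACG Γ)) = C.linearPartHom φ * C.linearPartHom φ :=
    C.linearPartHom.map_mul φ φ
  have h2 : IsUnit (C.linearPartHom φ).det :=
    (Matrix.isUnit_iff_isUnit_det _).1 ((Group.isUnit φ).map C.linearPartHom)
  rw [Matrix.det_unique] at h2
  rw [h1]
  ext i j
  rw [Matrix.mul_apply, Fintype.sum_unique, Matrix.one_apply_eq]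
  exact Int.isUnit_mul_self h2

lemma trans_sq_mul_sq_of_unit (C : PointedCoclique Γ Unit) (φ ψ : signStabilizer (RACG Γ))
    (y : RACG Γ) : C.trans (((φ * φ) * (ψ * ψ) : MulAut (RACG Γ)) y) =
      C.trans (((ψ * ψ) * (φ * φ) : MulAut (RACG Γ)) y) := by
  have key : ∀ φ ψ : signStabilizer (RACG Γ),
      (2 : ℤ) • C.trans (((φ * φ) * (ψ * ψ) : MulAut (RACG Γ)) y) =
      (2 : ℤ) • C.trans y +
        (1 - C.sgn y : ℤ) • C.trans ((ψ * ψ : MulAut (RACG Γ)) (RACG.of Γ (C.vertex none))) +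
        (1 - C.sgn y : ℤ) • C.trans ((φ * φ : MulAut (RACG Γ)) (RACG.of Γ (C.vertex none))) := by
    intro φ ψ
    have hφ : (φ * φ : MulAut (RACG Γ)) ∈ signStabilizer (RACG Γ) := (φ * φ).2
    have hψ : (ψ * ψ : MulAut (RACG Γ)) ∈ signStabilizer (RACG Γ) := (ψ * ψ).2
    rw [MulAut.mul_apply _ (φ * φ : MulAut (RACG Γ)), C.two_smul_trans_apply hφ,
      mem_signStabilizer.1 hψ, linearPart_sq_of_unit, Matrix.one_mulVec,
      C.two_smul_trans_apply hψ, linearPart_sq_of_unit, Matrix.one_mulVec]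
  have := (key φ ψ).trans ((add_right_comm _ _ _).trans (key ψ φ).symm)
  funext i
  simpa using congrFun this i

end PointedCoclique

lemma commute_sq_of_not_hasVertex {V : Type*} [Fintype V] {Γ : SimpleGraph V}
    (hΓ : ¬ HasVertexWithTwoNonNeighbors Γ) (φ ψ : signStabilizer (RACG Γ)) :
    Commute (φ * φ : MulAut (RACG Γ)) (ψ * ψ) := by
  ext y
  rw [← mul_inv_eq_one]
  have hsgn : ∀ χ : RACG Γ →* ℤˣ, χ (((φ * φ) * (ψ * ψ) : MulAut (RACG Γ)) y *
      (((ψ * ψ) * (φ * φ) : MulAut (RACG Γ)) y)⁻¹) = 1 := by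
    intro χ
    have h1 : ((φ * φ) * (ψ * ψ) : MulAut (RACG Γ)) ∈ signStabilizer (RACG Γ) :=
      ((φ * φ) * (ψ * ψ)).2
    have h2 : ((ψ * ψ) * (φ * φ) : MulAut (RACG Γ)) ∈ signStabilizer (RACG Γ) :=
      ((ψ * ψ) * (φ * φ)).2
    rw [map_mul, map_inv, mem_signStabilizer.1 h1, mem_signStabilizer.1 h2, mul_inv_cancel]
  refine RACG.eq_one_of_forall_kill_singleton fun v => ?_
  by_cases hv : ∃ w, w ≠ v ∧ ¬ Γ.Adj v w
  · obtain ⟨w, hwv, hvw⟩ := hv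
    let C : PointedCoclique Γ Unit :=
      { vertex := fun o => o.elim v fun _ => w
        injective := by
          rintro (_ | _) (_ | _) h
          · rfl
          · exact absurd h.symm hwv
          · exact absurd h hwv
          · rfl
        not_adj := by
          rintro (_ | _) (_ | _) h
          · exact Γ.irrefl h
          · exact hvw h
          · exact hvw h.symm
          · exact Γ.irrefl h }
    have hS : ∀ x ∈ Set.range C.vertex, ∀ y ∉ Set.range C.vertex, Γ.Adj x y := by
      rintro _ ⟨o, rfl⟩ y hy
      by_contra hn
      have hyv : y ≠ v := fun h => hy ⟨none, h.symm⟩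
      have hyw : y ≠ w := fun h => hy ⟨some (), h.symm⟩
      cases o with
      | none => exact hΓ ⟨v, w, y, hyw.symm, hwv, hyv, hvw, hn⟩
      | some _ => exact hΓ ⟨w, v, y, hyv.symm, hwv.symm, hyw, fun h => hvw h.symm, hn⟩
    refine RACG.kill_singleton_eq_self hS ⟨none, rfl⟩ ?_
    rw [C.kill_eq_of_unit, hsgn]
    have : C.trans (((φ * φ) * (ψ * ψ) : MulAut (RACG Γ)) y *
        (((ψ * ψ) * (φ * φ) : MulAut (RACG Γ)) y)⁻¹) = 0 := by
      have h := C.trans_mul (((φ * φ) * (ψ * ψ) : MulAut (RACG Γ)) y *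
        (((ψ * ψ) * (φ * φ) : MulAut (RACG Γ)) y)⁻¹) (((ψ * ψ) * (φ * φ) : MulAut (RACG Γ)) y)
      rw [inv_mul_cancel_right, hsgn, C.trans_sq_mul_sq_of_unit] at h
      simpa using h
    rw [this]
    simp
  · push Not at hv
    let C : PointedCoclique Γ Empty :=
      { vertex := fun _ => v
        injective := fun _ _ _ => Subsingleton.elim _ _
        not_adj := fun _ _ => Γ.irrefl }
    have hS : ∀ x ∈ Set.range C.vertex, ∀ y ∉ Set.range C.vertex, Γ.Adj x y := by
      rintro _ ⟨o, rfl⟩ y hy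
      exact hv y fun h => hy ⟨none, h.symm⟩
    refine RACG.kill_singleton_eq_self hS ⟨none, rfl⟩ ?_
    rw [C.kill_eq_of_isEmpty, hsgn, if_pos rfl]

theorem not_sqUniversal_of_not_hasVertex {V : Type*} [Fintype V] {Γ : SimpleGraph V}
    (hΓ : ¬ HasVertexWithTwoNonNeighbors Γ) : ¬ SQUniversal (MulAut (RACG Γ)) := by
  intro h
  have : Countable (Matrix (Fin 2) (Fin 2) ℤ) := inferInstanceAs (Countable (Fin 2 → Fin 2 → ℤ))
  have : Countable (Matrix.SpecialLinearGroup (Fin 2) ℤ) :=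
    (Subtype.val_injective (p := fun A : Matrix (Fin 2) (Fin 2) ℤ => A.det = 1)).countable
  obtain ⟨N, hN, f, hf⟩ := h (Matrix.SpecialLinearGroup (Fin 2) ℤ)
  set n := Nat.card (Perm (RACG Γ →* ℤˣ)) with hn
  have hn0 : n ≠ 0 := Nat.card_pos.ne'
  have hmem : ∀ φ : MulAut (RACG Γ), φ ^ n ∈ signStabilizer (RACG Γ) := fun φ => by
    rw [signStabilizer, MonoidHom.mem_ker, map_pow, hn, pow_card_eq_one']
  have hcomm : ∀ φ ψ : MulAut (RACG Γ), Commute (φ ^ (n * 2)) (ψ ^ (n * 2)) := fun φ ψ => by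
    rw [pow_mul, pow_mul, sq, sq]
    exact commute_sq_of_not_hasVertex hΓ ⟨_, hmem φ⟩ ⟨_, hmem ψ⟩
  refine modularGroup_not_commute (m := n * 2) (n := n * 2) (by simpa) (by simpa) ?_
  apply hf
  rw [map_mul, map_mul, map_pow, map_pow]
  obtain ⟨φ, hφ⟩ := QuotientGroup.mk'_surjective N (f ModularGroup.T)
  obtain ⟨ψ, hψ⟩ := QuotientGroup.mk'_surjective N
    (f (ModularGroup.S * ModularGroup.T * ModularGroup.S⁻¹))
  rw [← hφ, ← hψ, ← map_pow, ← map_pow]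
  exact ((hcomm φ ψ).map (QuotientGroup.mk' N)).eq

/-- The integral matrix with rows `(a, b)` and `(c, -a)`, of determinant `-1`. -/
noncomputable def reflection (a b c : ℤ) (h : a ^ 2 + b * c = 1) : GL (Fin 2) ℤ :=
  intGL a b c (-a) (by
    rw [show a * -a - b * c = -(a ^ 2 + b * c) by ring, h]
    exact isUnit_one.neg)

@[simp] lemma coe_reflection (a b c : ℤ) (h : a ^ 2 + b * c = 1) :
    (reflection a b c h : Matrix (Fin 2) (Fin 2) ℤ) = !![a, b; c, -a] := rfl

lemma pgl_mk_eq_mk_iff {A B : GL (Fin 2) ℤ} :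
    ProjGenLinGroup.mk A = ProjGenLinGroup.mk B ↔
      ∃ e : ℤ, (e = 1 ∨ e = -1) ∧ A 0 0 = e * B 0 0 ∧ A 0 1 = e * B 0 1 ∧
        A 1 0 = e * B 1 0 ∧ A 1 1 = e * B 1 1 := by
  have hs : ∀ (u : ℤˣ) (i j : Fin 2), Matrix.GeneralLinearGroup.scalar (Fin 2) u i j =
      if i = j then (u : ℤ) else 0 := fun u i j => Matrix.diagonal_apply _ i j
  rw [eq_comm, Matrix.ProjGenLinGroup.mk_eq_mk_iff]
  constructor
  · rintro ⟨u, rfl⟩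
    refine ⟨u, Int.isUnit_iff.1 u.isUnit, ?_⟩
    simp only [GL_mul_apply_fin_two, hs]
    simp [mul_comm]
  · rintro ⟨e, he, h00, h01, h10, h11⟩
    refine ⟨(Int.isUnit_iff.2 he).unit, ?_⟩
    apply GL_ext_fin_two <;> rw [GL_mul_apply_fin_two, hs, hs] <;> simp [*, mul_comm]

lemma pgl_mk_mul_eq_mk_mul_iff {A B C D : GL (Fin 2) ℤ} :
    ProjGenLinGroup.mk A * ProjGenLinGroup.mk B = ProjGenLinGroup.mk C * ProjGenLinGroup.mk D ↔
      ∃ e : ℤ, (e = 1 ∨ e = -1) ∧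
        A 0 0 * B 0 0 + A 0 1 * B 1 0 = e * (C 0 0 * D 0 0 + C 0 1 * D 1 0) ∧
        A 0 0 * B 0 1 + A 0 1 * B 1 1 = e * (C 0 0 * D 0 1 + C 0 1 * D 1 1) ∧
        A 1 0 * B 0 0 + A 1 1 * B 1 0 = e * (C 1 0 * D 0 0 + C 1 1 * D 1 0) ∧
        A 1 0 * B 0 1 + A 1 1 * B 1 1 = e * (C 1 0 * D 0 1 + C 1 1 * D 1 1) := by
  rw [← map_mul, ← map_mul, pgl_mk_eq_mk_iff]
  simp only [GL_mul_apply_fin_two]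

lemma pgl_mk_mul_self_eq_one_iff {A : GL (Fin 2) ℤ} :
    ProjGenLinGroup.mk A * ProjGenLinGroup.mk A = 1 ↔
      ∃ e : ℤ, (e = 1 ∨ e = -1) ∧ A 0 0 * A 0 0 + A 0 1 * A 1 0 = e ∧
        A 0 0 * A 0 1 + A 0 1 * A 1 1 = 0 ∧
        A 1 0 * A 0 0 + A 1 1 * A 1 0 = 0 ∧ A 1 0 * A 0 1 + A 1 1 * A 1 1 = e := by
  rw [← map_mul, ← map_one ProjGenLinGroup.mk, pgl_mk_eq_mk_iff]
  simp only [GL_mul_apply_fin_two]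
  simp only [Units.val_one, Matrix.one_apply_eq, ne_eq, zero_ne_one, one_ne_zero, not_false_eq_true,
    Matrix.one_apply_ne, mul_one, mul_zero]

lemma reflection_mul_self (a b c : ℤ) (h : a ^ 2 + b * c = 1) :
    ProjGenLinGroup.mk (reflection a b c h) * ProjGenLinGroup.mk (reflection a b c h) = 1 := by
  rw [pgl_mk_mul_self_eq_one_iff]
  refine ⟨1, Or.inl rfl, ?_⟩
  simp only [coe_reflection, Matrix.of_apply, Matrix.cons_val', Matrix.cons_val_zero,
    Matrix.cons_val_one, Matrix.cons_val_fin_one]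
  refine ⟨by linarith, by ring, by ring, by linarith⟩

lemma pgl_mk_eq_one_of_det_eq_one {A : GL (Fin 2) ℤ} (hdet : A 0 0 * A 1 1 - A 0 1 * A 1 0 = 1)
    (h00 : A 0 0 % 2 = 1) (h01 : A 0 1 % 2 = 0) (h10 : A 1 0 % 2 = 0)
    (hsq : ProjGenLinGroup.mk A * ProjGenLinGroup.mk A = 1) : ProjGenLinGroup.mk A = 1 := by
  obtain ⟨e, he, e00, e01, e10, e11⟩ := pgl_mk_mul_self_eq_one_iff.1 hsq
  have hne : A 0 0 + A 1 1 ≠ 0 := by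
    intro h
    obtain ⟨k, hk⟩ : ∃ k, A 0 0 = 2 * k + 1 := ⟨A 0 0 / 2, by omega⟩
    obtain ⟨l, hl⟩ : ∃ l, A 0 1 = 2 * l := ⟨A 0 1 / 2, by omega⟩
    obtain ⟨m, hm⟩ : ∃ m, A 1 0 = 2 * m := ⟨A 1 0 / 2, by omega⟩
    have h11 : A 1 1 = -(2 * k + 1) := by linarith
    rw [h11, hk, hl, hm] at hdet
    have : 4 * (k * k + k + l * m) = -2 := by linear_combination -hdet
    omega
  have h01 : A 0 1 = 0 :=
    (mul_eq_zero.1 (show A 0 1 * (A 0 0 + A 1 1) = 0 by linarith)).resolve_right hne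
  have h10 : A 1 0 = 0 :=
    (mul_eq_zero.1 (show A 1 0 * (A 0 0 + A 1 1) = 0 by linarith)).resolve_right hne
  rw [h01, zero_mul, sub_zero] at hdet
  rw [← map_one ProjGenLinGroup.mk, pgl_mk_eq_mk_iff]
  rcases Int.eq_one_or_neg_one_of_mul_eq_one' hdet with ⟨h1, h2⟩ | ⟨h1, h2⟩
  · exact ⟨1, Or.inl rfl, by simp [*]⟩
  · exact ⟨-1, Or.inr rfl, by simp [*]⟩

lemma trace_eq_zero_of_det_eq_neg_one {A : GL (Fin 2) ℤ}
    (hdet : A 0 0 * A 1 1 - A 0 1 * A 1 0 = -1)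
    (hsq : ProjGenLinGroup.mk A * ProjGenLinGroup.mk A = 1) : A 1 1 = -A 0 0 := by
  obtain ⟨e, he, e00, e01, e10, e11⟩ := pgl_mk_mul_self_eq_one_iff.1 hsq
  by_contra hne
  have hne : A 0 0 + A 1 1 ≠ 0 := fun h => hne (by linarith)
  have h01 : A 0 1 = 0 :=
    (mul_eq_zero.1 (show A 0 1 * (A 0 0 + A 1 1) = 0 by linarith)).resolve_right hne
  rw [h01, zero_mul, sub_zero] at hdet
  rcases Int.eq_one_or_neg_one_of_mul_eq_neg_one' hdet with ⟨h1, h2⟩ | ⟨h1, h2⟩ <;> omega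

lemma exists_eq_reflection {A : GL (Fin 2) ℤ}
    (hdet : A 0 0 * A 1 1 - A 0 1 * A 1 0 = -1)
    (hsq : ProjGenLinGroup.mk A * ProjGenLinGroup.mk A = 1) :
    ∃ h, A = reflection (A 0 0) (A 0 1) (A 1 0) h := by
  have htr := trace_eq_zero_of_det_eq_neg_one hdet hsq
  refine ⟨by rw [htr] at hdet; linarith, ?_⟩
  apply GL_ext_fin_two <;> simp [htr]

lemma trace_mul_eq_zero_of_commute {a b c x y z : ℤ} {h : a ^ 2 + b * c = 1}
    {h' : x ^ 2 + y * z = 1} (ha : a % 2 = 1) (hb : b % 2 = 0) (hy : y % 2 = 1)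
    (hcomm : Commute (ProjGenLinGroup.mk (reflection a b c h))
      (ProjGenLinGroup.mk (reflection x y z h'))) : 2 * a * x + b * z + c * y = 0 := by
  obtain ⟨e, he, e00, e01, -, -⟩ := pgl_mk_mul_eq_mk_mul_iff.1 hcomm.eq
  simp only [coe_reflection, Matrix.of_apply, Matrix.cons_val', Matrix.cons_val_zero,
    Matrix.cons_val_one, Matrix.cons_val_fin_one] at e00 e01
  rcases he with rfl | rfl
  · have h1 : a * y = b * x := by linarith
    have h2 : a * y % 2 = 1 := by rw [Int.mul_emod, ha, hy]; rfl
    have h3 : b * x % 2 = 0 := by rw [Int.mul_emod, hb]; simp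
    omega
  · linarith

lemma exists_rank_one_factorization {m b c : ℤ} (h : m * (1 - m) = b * c) :
    ∃ p q r s : ℤ, p * r = m ∧ p * s = b ∧ q * r = c ∧ q * s = 1 - m := by
  by_cases h0 : Int.gcd m b = 0
  · obtain ⟨rfl, rfl⟩ := Int.gcd_eq_zero_iff.1 h0
    exact ⟨0, 1, c, 1, by simp⟩
  · obtain ⟨r, s, hrs, hm, hb⟩ := Int.exists_gcd_one (Nat.pos_of_ne_zero h0)
    set p : ℤ := (Int.gcd m b : ℤ) with hp
    have hp0 : p ≠ 0 := by simpa [hp] using h0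
    have h1 : r * (1 - m) = s * c := by
      apply mul_left_cancel₀ hp0
      calc p * (r * (1 - m)) = (r * p) * (1 - m) := by ring
        _ = m * (1 - m) := by rw [← hm]
        _ = b * c := h
        _ = (s * p) * c := by rw [← hb]
        _ = p * (s * c) := by ring
    by_cases hr : r = 0
    · subst hr
      have hs : s * s = 1 := by
        rw [Int.gcd_zero_left] at hrs
        exact Int.isUnit_mul_self (Int.isUnit_iff_natAbs_eq.2 hrs)
      have hs0 : s ≠ 0 := by rintro rfl; simp at hs
      have hc : c = 0 := by
        rw [zero_mul] at h1
        exact (mul_eq_zero.1 h1.symm).resolve_left hs0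
      exact ⟨p, s, 0, s, by rw [hm]; ring, by rw [hb]; ring, by simp [hc], by rw [hm, hs]; ring⟩
    · obtain ⟨q, hq⟩ := (Int.isCoprime_iff_gcd_eq_one.2 hrs).dvd_of_dvd_mul_left ⟨_, h1.symm⟩
      refine ⟨p, q, r, s, by rw [mul_comm]; exact hm.symm, by rw [mul_comm]; exact hb.symm,
        by rw [hq]; ring, ?_⟩
      apply mul_left_cancel₀ hr
      rw [h1, hq]; ring

/-- The diagonal reflection. -/
noncomputable def diagReflection : GL (Fin 2) ℤ := reflection (-1) 0 0 (by norm_num)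

/-- The reflection swapping the coordinates. -/
noncomputable def swapReflection : GL (Fin 2) ℤ := reflection 0 1 1 (by norm_num)

/-- The reflection which, with the diagonal one, generates the translations by `2`. -/
noncomputable def shearReflection : GL (Fin 2) ℤ := reflection (-1) 2 0 (by norm_num)

lemma commute_diagReflection_swapReflection :
    Commute (ProjGenLinGroup.mk diagReflection) (ProjGenLinGroup.mk swapReflection) :=
  pgl_mk_mul_eq_mk_mul_iff.2 ⟨-1, by simp [diagReflection, swapReflection]⟩

lemma exists_conj_diagReflection_swapReflection {a b c x y z : ℤ} {h : a ^ 2 + b * c = 1}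
    {h' : x ^ 2 + y * z = 1} (ha : a % 2 = 1) (hb : b % 2 = 0) (hc : c % 2 = 0)
    (htr : 2 * a * x + b * z + c * y = 0) :
    ∃ g : GL (Fin 2) ℤ,
      ProjGenLinGroup.mk (reflection a b c h) * ProjGenLinGroup.mk g =
        ProjGenLinGroup.mk g * ProjGenLinGroup.mk diagReflection ∧
      ProjGenLinGroup.mk (reflection x y z h') * ProjGenLinGroup.mk g =
        ProjGenLinGroup.mk g * ProjGenLinGroup.mk swapReflection := by
  obtain ⟨m, rfl⟩ : ∃ m, a = 2 * m - 1 := ⟨(a + 1) / 2, by omega⟩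
  obtain ⟨b, rfl⟩ : ∃ m, b = 2 * m := ⟨b / 2, by omega⟩
  obtain ⟨c, rfl⟩ : ∃ m, c = 2 * m := ⟨c / 2, by omega⟩
  obtain ⟨p, q, r, s, rfl, rfl, rfl, hqs⟩ :=
    exists_rank_one_factorization (show m * (1 - m) = b * c by linarith)
  have htr' : x * (p * r - q * s) + y * q * r + z * p * s = 0 := by rw [hqs]; linarith
  have hdet : p * r + q * s = 1 := by linarith
  have ht : (-2 * p * q * x - y * q ^ 2 + z * p ^ 2) * (-2 * r * s * x + y * r ^ 2 - z * s ^ 2) =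
      1 := by
    have h1 : (-2 * p * q * x - y * q ^ 2 + z * p ^ 2) *
        (-2 * r * s * x + y * r ^ 2 - z * s ^ 2) = (x ^ 2 + y * z) * (p * r + q * s) ^ 2 -
        (x * (p * r - q * s) + y * q * r + z * p * s) ^ 2 := by ring
    rw [h1, htr', hdet, h']; norm_num
  have hu : IsUnit (-s * q - p * r) := by
    rw [show -s * q - p * r = -1 by linarith]; exact isUnit_one.neg
  refine ⟨intGL (-s) p r q hu, pgl_mk_mul_eq_mk_mul_iff.2 ⟨1, Or.inl rfl, ?_⟩,
    pgl_mk_mul_eq_mk_mul_iff.2 ?_⟩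
  · simp only [coe_reflection, diagReflection, coe_intGL, Matrix.of_apply, Matrix.cons_val',
      Matrix.cons_val_zero, Matrix.cons_val_one, Matrix.cons_val_fin_one]
    refine ⟨by ring, ?_, ?_, by ring⟩
    · linear_combination (2 * p) * hdet
    · linear_combination (-2 * r) * hdet
  · have e00 : x * -s + y * r = p * (-2 * r * s * x + y * r ^ 2 - z * s ^ 2) := by
      linear_combination (x * s - y * r) * hdet + s * htr'
    have e10 : z * -s + -x * r = q * (-2 * r * s * x + y * r ^ 2 - z * s ^ 2) := by
      linear_combination (z * s + x * r) * hdet - r * htr'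
    have e01 : x * p + y * q = -s * (-2 * p * q * x - y * q ^ 2 + z * p ^ 2) := by
      linear_combination -(x * p + y * q) * hdet + p * htr'
    have e11 : z * p + -x * q = r * (-2 * p * q * x - y * q ^ 2 + z * p ^ 2) := by
      linear_combination -(z * p - x * q) * hdet + q * htr'
    refine ⟨-2 * p * q * x - y * q ^ 2 + z * p ^ 2, ?_⟩
    simp only [coe_reflection, swapReflection, coe_intGL, Matrix.of_apply, Matrix.cons_val',
      Matrix.cons_val_zero, Matrix.cons_val_one, Matrix.cons_val_fin_one]
    rcases Int.eq_one_or_neg_one_of_mul_eq_one' ht with ⟨h1, h2⟩ | ⟨h1, h2⟩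
    · rw [h2] at e00 e10
      rw [h1] at e01 e11 ⊢
      exact ⟨Or.inl rfl, by linarith, by linarith, by linarith, by linarith⟩
    · rw [h2] at e00 e10
      rw [h1] at e01 e11 ⊢
      exact ⟨Or.inr rfl, by linarith, by linarith, by linarith, by linarith⟩

lemma exists_conj_reflection (g : GL (Fin 2) ℤ) {a b c : ℤ} (h : a ^ 2 + b * c = 1)
    (hb : b % 2 = 0) (hc : c % 2 = 0) :
    ∃ (d f k : ℤ) (h' : (2 * k + 1) ^ 2 + (f + d) * (f - d) = 1), (f + d) % 2 = 0 ∧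
      ProjGenLinGroup.mk (reflection a b c h) * ProjGenLinGroup.mk g =
        ProjGenLinGroup.mk g * ProjGenLinGroup.mk (reflection (2 * k + 1) (f + d) (f - d) h') := by
  obtain ⟨b, rfl⟩ : ∃ m, b = 2 * m := ⟨b / 2, by omega⟩
  obtain ⟨c, rfl⟩ : ∃ m, c = 2 * m := ⟨c / 2, by omega⟩
  obtain ⟨e, he, hdet⟩ : ∃ e : ℤ, (e = 1 ∨ e = -1) ∧ g 0 0 * g 1 1 - g 0 1 * g 1 0 = e :=
    ⟨_, Int.isUnit_iff.1 (isUnit_det_fin_two g), rfl⟩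
  have he2 : e * e = 1 := by rcases he with rfl | rfl <;> rfl
  set d := a * (g 0 1 * g 1 1 + g 0 0 * g 1 0) + b * (g 1 1 ^ 2 + g 1 0 ^ 2) -
    c * (g 0 1 ^ 2 + g 0 0 ^ 2) with hd
  set f := a * (g 0 1 * g 1 1 - g 0 0 * g 1 0) + b * (g 1 1 ^ 2 - g 1 0 ^ 2) -
    c * (g 0 1 ^ 2 - g 0 0 ^ 2) with hf
  set n := a * (g 0 0 * g 1 1 + g 0 1 * g 1 0) + 2 * b * (g 1 0 * g 1 1) -
    2 * c * (g 0 0 * g 0 1) with hn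
  have hfd : f + d = 2 * (a * (g 0 1 * g 1 1) + b * g 1 1 ^ 2 - c * g 0 1 ^ 2) := by
    rw [hd, hf]; ring
  have hfd' : f - d = 2 * (-a * (g 0 0 * g 1 0) - b * g 1 0 ^ 2 + c * g 0 0 ^ 2) := by
    rw [hd, hf]; ring
  have hsum : n ^ 2 + (f + d) * (f - d) = 1 := by
    have : n ^ 2 + (f + d) * (f - d) =
        (a ^ 2 + 2 * b * (2 * c)) * (g 0 0 * g 1 1 - g 0 1 * g 1 0) ^ 2 := by
      rw [hfd, hfd', hn]; ring
    rw [this, h, hdet, sq, he2]; rfl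
  obtain ⟨k, hk⟩ : ∃ k, n = 2 * k + 1 := by
    rcases Int.even_or_odd' n with ⟨k, hk | hk⟩
    · exfalso
      rw [hk, hfd, hfd'] at hsum
      have : ∀ k P Q : ℤ, (2 * k) ^ 2 + 2 * P * (2 * Q) ≠ 1 := fun k P Q h => by
        have : 4 * (k * k + P * Q) = 1 := by linarith
        omega
      exact this _ _ _ hsum
    · exact ⟨k, hk⟩
  refine ⟨d, f, k, by rw [← hk]; exact hsum, by rw [hfd]; simp, ?_⟩
  rw [pgl_mk_mul_eq_mk_mul_iff]
  refine ⟨e, he, ?_⟩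
  simp only [coe_reflection, Matrix.of_apply, Matrix.cons_val', Matrix.cons_val_zero,
    Matrix.cons_val_one, Matrix.cons_val_fin_one]
  rw [← hk, hfd, hfd', hn, ← hdet]
  rw [← hdet] at he2
  refine ⟨?_, ?_, ?_, ?_⟩
  · linear_combination -(a * g 0 0 + 2 * b * g 1 0) * he2
  · linear_combination -(a * g 0 1 + 2 * b * g 1 1) * he2
  · linear_combination -(2 * c * g 0 0 - a * g 1 0) * he2
  · linear_combination -(2 * c * g 0 1 - a * g 1 1) * he2

/-- The matrices in `ℤ[J] + d • ℤ[J] V`, where `V` is the diagonal reflection and `J` is the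
rotation of order four. -/
def IsEvenForm (d : ℤ) (A : GL (Fin 2) ℤ) : Prop :=
  ∃ x y z t : ℤ, A 0 0 = x - d * z ∧ A 0 1 = -y + d * t ∧ A 1 0 = y + d * t ∧ A 1 1 = x + d * z

/-- The matrices in `ℤ[J] V + d • ℤ[J]`, where `V` is the diagonal reflection and `J` is the
rotation of order four. -/
def IsOddForm (d : ℤ) (A : GL (Fin 2) ℤ) : Prop :=
  ∃ x y z t : ℤ, A 0 0 = -x + d * z ∧ A 0 1 = y - d * t ∧ A 1 0 = y + d * t ∧ A 1 1 = x + d * z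

lemma IsOddForm.mul_isEvenForm {d : ℤ} {A B : GL (Fin 2) ℤ} (hA : IsOddForm d A)
    (hB : IsEvenForm d B) : IsOddForm d (A * B) := by
  obtain ⟨x, y, z, t, h00, h01, h10, h11⟩ := hA
  obtain ⟨x', y', z', t', h00', h01', h10', h11'⟩ := hB
  refine ⟨x * x' - y * y' + d ^ 2 * z * z' + d ^ 2 * t * t',
    x * y' + y * x' + d ^ 2 * z * t' - d ^ 2 * t * z', x * z' + y * t' + z * x' - t * y',
    x * t' - y * z' + z * y' + t * x', ?_⟩
  simp only [GL_mul_apply_fin_two, *]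
  refine ⟨?_, ?_, ?_, ?_⟩ <;> ring

lemma IsOddForm.mul_isOddForm {d : ℤ} {A B : GL (Fin 2) ℤ} (hA : IsOddForm d A)
    (hB : IsOddForm d B) : IsEvenForm d (A * B) := by
  obtain ⟨x, y, z, t, h00, h01, h10, h11⟩ := hA
  obtain ⟨x', y', z', t', h00', h01', h10', h11'⟩ := hB
  refine ⟨x * x' + y * y' + d ^ 2 * z * z' - d ^ 2 * t * t',
    x * y' - y * x' + d ^ 2 * z * t' + d ^ 2 * t * z', x * z' - y * t' + z * x' + t * y',
    x * t' + y * z' + z * y' - t * x', ?_⟩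
  simp only [GL_mul_apply_fin_two, *]
  refine ⟨?_, ?_, ?_, ?_⟩ <;> ring

lemma isEvenForm_one (d : ℤ) : IsEvenForm d 1 := ⟨1, 0, 0, 0, by simp⟩

lemma isOddForm_diagReflection (d : ℤ) : IsOddForm d diagReflection :=
  ⟨1, 0, 0, 0, by simp [diagReflection]⟩

lemma isOddForm_swapReflection (d : ℤ) : IsOddForm d swapReflection :=
  ⟨0, 1, 0, 0, by simp [swapReflection]⟩

lemma isOddForm_reflection {d f a : ℤ} (h : a ^ 2 + (f + d) * (f - d) = 1) :
    IsOddForm d (reflection a (f + d) (f - d) h) :=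
  ⟨-a, f, 0, -1, by simp; ring⟩

lemma IsOddForm.dvd_of_conj {d : ℤ} {A B g : GL (Fin 2) ℤ} (hA : IsOddForm d A)
    (h : ProjGenLinGroup.mk g * ProjGenLinGroup.mk A =
      ProjGenLinGroup.mk B * ProjGenLinGroup.mk g) :
    2 * d ∣ g 0 0 * (B 1 0 * g 0 0 + B 1 1 * g 1 0) - g 1 0 * (B 0 0 * g 0 0 + B 0 1 * g 1 0) -
      (g 1 1 * (B 0 0 * g 0 1 + B 0 1 * g 1 1) - g 0 1 * (B 1 0 * g 0 1 + B 1 1 * g 1 1)) := by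
  obtain ⟨x, y, z, t, h00, h01, h10, h11⟩ := hA
  obtain ⟨e, he, e00, e01, e10, e11⟩ := pgl_mk_mul_eq_mk_mul_iff.1 h
  have he2 : e * e = 1 := by rcases he with rfl | rfl <;> rfl
  refine ⟨e * (g 0 0 * g 1 1 - g 0 1 * g 1 0) * t, ?_⟩
  have : 2 * d * (e * (g 0 0 * g 1 1 - g 0 1 * g 1 0) * t) =
      e * (g 0 0 * g 1 1 - g 0 1 * g 1 0) * (A 1 0 - A 0 1) := by rw [h10, h01]; ring
  rw [this]
  linear_combination (-e * g 0 0) * e10 + e * g 1 0 * e00 + e * g 1 1 * e01 - e * g 0 1 * e11 -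
    (g 0 0 * (B 1 0 * g 0 0 + B 1 1 * g 1 0) - g 1 0 * (B 0 0 * g 0 0 + B 0 1 * g 1 0) -
      (g 1 1 * (B 0 0 * g 0 1 + B 0 1 * g 1 1) - g 0 1 * (B 1 0 * g 0 1 + B 1 1 * g 1 1))) * he2

lemma isUnit_of_forall_exists_isOddForm {d : ℤ} (g : GL (Fin 2) ℤ)
    (h : ∀ B ∈ ({diagReflection, swapReflection, shearReflection} : Set (GL (Fin 2) ℤ)),
      ∃ A, IsOddForm d A ∧ ProjGenLinGroup.mk g * ProjGenLinGroup.mk A =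
        ProjGenLinGroup.mk B * ProjGenLinGroup.mk g) : d = 1 ∨ d = -1 := by
  obtain ⟨A, hA, e⟩ := h diagReflection (by simp)
  obtain ⟨A', hA', e'⟩ := h swapReflection (by simp)
  obtain ⟨A'', hA'', e''⟩ := h shearReflection (by simp)
  have h1 := hA.dvd_of_conj e
  have h2 := hA'.dvd_of_conj e'
  have h3 := hA''.dvd_of_conj e''
  have hdet := isUnit_det_fin_two g
  simp only [coe_reflection, diagReflection, swapReflection, shearReflection, Matrix.of_apply,
    Matrix.cons_val', Matrix.cons_val_zero, Matrix.cons_val_one,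
    Matrix.cons_val_fin_one] at h1 h2 h3
  obtain ⟨k, hk⟩ := h1
  obtain ⟨l, hl⟩ := h2
  obtain ⟨m, hm⟩ := h3
  generalize g 0 0 = α at *
  generalize g 0 1 = β at *
  generalize g 1 0 = γ at *
  generalize g 1 1 = δ at *
  have hk : α * γ + β * δ = d * k := by linarith
  have hm : γ ^ 2 + δ ^ 2 = d * (k - m) := by linarith
  have hl : α ^ 2 + β ^ 2 = d * (k - m + 2 * l) := by linarith
  have h4 := Int.isUnit_mul_self hdet
  rw [← Int.isUnit_iff]
  apply isUnit_of_dvd_one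
  refine ⟨d * ((k - m + 2 * l) * (k - m) - k * k), ?_⟩
  rw [← h4]
  linear_combination (α ^ 2 + β ^ 2) * hm + d * (k - m) * hl - (α * γ + β * δ + d * k) * hk

lemma exists_conj_shearReflection {d f k : ℤ}
    (h : (2 * k + 1) ^ 2 + (f + d) * (f - d) = 1) (heven : (f + d) % 2 = 0)
    (hd : d = 1 ∨ d = -1) :
    ∃ g : GL (Fin 2) ℤ,
      ProjGenLinGroup.mk (reflection (2 * k + 1) (f + d) (f - d) h) * ProjGenLinGroup.mk g =
        ProjGenLinGroup.mk g * ProjGenLinGroup.mk shearReflection ∧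
      Commute (ProjGenLinGroup.mk diagReflection) (ProjGenLinGroup.mk g) ∧
      Commute (ProjGenLinGroup.mk swapReflection) (ProjGenLinGroup.mk g) := by
  obtain ⟨l, hl⟩ : ∃ l, f = 2 * l + d := ⟨(f - d) / 2, by omega⟩
  have h1 : k * (k + 1) + l * (l + d) = 0 := by
    rw [hl] at h; linarith
  have h2 : k * (k + 1) = 0 ∧ l * (l + d) = 0 := by
    have h3 : 0 ≤ k * (k + 1) := by
      rcases le_or_gt 0 k with h | h <;> nlinarith
    have h4 : 0 ≤ l * (l + d) := by
      rcases hd with rfl | rfl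
      · rcases le_or_gt 0 l with h | h <;> nlinarith
      · rcases le_or_gt l 0 with h | h <;> nlinarith
    exact ⟨by linarith, by linarith⟩
  have hcomm := commute_diagReflection_swapReflection
  have hid : ∀ B : ProjGenLinGroup (Fin 2) ℤ, Commute B (ProjGenLinGroup.mk 1) := fun B => by
    rw [map_one]; exact Commute.one_right B
  have hdiag : Commute (ProjGenLinGroup.mk diagReflection)
      (ProjGenLinGroup.mk (diagReflection * swapReflection)) := by
    rw [map_mul]; exact (Commute.refl _).mul_right hcomm
  have hswap : Commute (ProjGenLinGroup.mk swapReflection)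
      (ProjGenLinGroup.mk (diagReflection * swapReflection)) := by
    rw [map_mul]; exact hcomm.symm.mul_right (Commute.refl _)
  rcases mul_eq_zero.1 h2.1 with hk | hk <;> rcases mul_eq_zero.1 h2.2 with hl' | hl' <;>
    rcases hd with hd | hd
  · refine ⟨diagReflection, pgl_mk_mul_eq_mk_mul_iff.2 ⟨-1, Or.inr rfl, ?_⟩, Commute.refl _,
      hcomm.symm⟩
    simp [diagReflection, shearReflection, hl, hk, hl', hd]
  · refine ⟨1, pgl_mk_mul_eq_mk_mul_iff.2 ⟨-1, Or.inr rfl, ?_⟩, hid _, hid _⟩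
    simp [shearReflection, hl, hk, hl', hd]
  · obtain rfl : l = -1 := by omega
    refine ⟨diagReflection * swapReflection, pgl_mk_mul_eq_mk_mul_iff.2 ⟨1, Or.inl rfl, ?_⟩,
      hdiag, hswap⟩
    simp only [GL_mul_apply_fin_two]
    simp [diagReflection, swapReflection, shearReflection, hl, hk, hd]
  · obtain rfl : l = 1 := by omega
    refine ⟨swapReflection, pgl_mk_mul_eq_mk_mul_iff.2 ⟨1, Or.inl rfl, ?_⟩, hcomm,
      Commute.refl _⟩
    simp [swapReflection, shearReflection, hl, hk, hd]
  · obtain rfl : k = -1 := by omega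
    refine ⟨1, pgl_mk_mul_eq_mk_mul_iff.2 ⟨1, Or.inl rfl, ?_⟩, hid _, hid _⟩
    simp [shearReflection, hl, hl', hd]
  · obtain rfl : k = -1 := by omega
    refine ⟨diagReflection, pgl_mk_mul_eq_mk_mul_iff.2 ⟨1, Or.inl rfl, ?_⟩, Commute.refl _,
      hcomm.symm⟩
    simp [diagReflection, shearReflection, hl, hl', hd]
  · obtain rfl : k = -1 := by omega
    obtain rfl : l = -1 := by omega
    refine ⟨swapReflection, pgl_mk_mul_eq_mk_mul_iff.2 ⟨-1, Or.inr rfl, ?_⟩, hcomm,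
      Commute.refl _⟩
    simp [swapReflection, shearReflection, hl, hd]
  · obtain rfl : k = -1 := by omega
    obtain rfl : l = 1 := by omega
    refine ⟨diagReflection * swapReflection, pgl_mk_mul_eq_mk_mul_iff.2 ⟨-1, Or.inr rfl, ?_⟩,
      hdiag, hswap⟩
    simp only [GL_mul_apply_fin_two]
    simp [diagReflection, swapReflection, shearReflection, hl, hd]

lemma eq_one_of_commute_reflections {p : ProjGenLinGroup (Fin 2) ℤ}
    (hd : Commute p (ProjGenLinGroup.mk diagReflection))
    (hu : Commute p (ProjGenLinGroup.mk shearReflection)) : p = 1 := by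
  obtain ⟨A, rfl⟩ := Matrix.ProjGenLinGroup.mk_surjective p
  obtain ⟨e, he, e00, e01, e10, e11⟩ := pgl_mk_mul_eq_mk_mul_iff.1 hd.eq
  obtain ⟨e', he', e00', e01', e10', e11'⟩ := pgl_mk_mul_eq_mk_mul_iff.1 hu.eq
  have hdet := isUnit_det_fin_two A
  simp [diagReflection] at e00 e01 e10 e11
  simp [shearReflection] at e00' e01' e10' e11'
  have h0 : A 0 0 ≠ 0 ∨ A 1 0 ≠ 0 := by
    by_contra! h
    rw [h.1, h.2] at hdet
    simp at hdet
  have h2 : A 0 1 = 0 ∧ A 1 0 = 0 ∧ A 0 0 = A 1 1 := by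
    rcases he with rfl | rfl <;> rcases he' with rfl | rfl <;> omega
  obtain ⟨h01, h10, h00⟩ := h2
  rw [h01, h00, zero_mul, sub_zero] at hdet
  rw [← map_one ProjGenLinGroup.mk, pgl_mk_eq_mk_iff]
  exact ⟨A 1 1, Int.isUnit_iff.1 (isUnit_of_mul_isUnit_left hdet), by simp [h00, h01, h10]⟩

lemma eq_of_conj_eq_conj {W P : Type*} [Group W] [Group P] {ρ : W →* P}
    (hρ : ∀ p : P, (∀ y, Commute p (ρ y)) → p = 1) {g g' : P}
    (h : ∀ y, g * ρ y * g⁻¹ = g' * ρ y * g'⁻¹) : g = g' := by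
  rw [← inv_mul_eq_one]
  refine hρ _ fun y => ?_
  rw [commute_iff_eq, mul_assoc, inv_mul_eq_iff_eq_mul, ← mul_assoc, ← mul_assoc, h,
    inv_mul_cancel_right]

/-- If the automorphisms in `H` are induced, through a homomorphism `ρ` whose image has trivial
centralizer, by conjugations in the target, then conjugators form a homomorphism on `H`. -/
lemma exists_conjugator_hom {W P : Type*} [Group W] [Group P] (ρ : W →* P)
    (hρ : ∀ p : P, (∀ y, Commute p (ρ y)) → p = 1) (H : Subgroup (MulAut W))
    (h : ∀ φ ∈ H, ∃ g : P, ∀ y, ρ (φ y) = g * ρ y * g⁻¹) :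
    ∃ θ : H →* P, ∀ (φ : H) (y : W), ρ ((φ : MulAut W) y) = θ φ * ρ y * (θ φ)⁻¹ := by
  choose f hf using fun φ : H => h φ φ.2
  refine ⟨{ toFun := f
            map_one' := eq_of_conj_eq_conj hρ fun y => ?_
            map_mul' := fun φ ψ => eq_of_conj_eq_conj hρ fun y => ?_ }, hf⟩
  · rw [← hf]; simp
  · rw [← hf, Subgroup.coe_mul, MulAut.mul_apply, hf, hf]
    group

namespace RACG

variable {V : Type*} {Γ : SimpleGraph V} {u v w : V}

open Classical in
/-- The representation of a right-angled Coxeter group in `PGL(2, ℤ)` attached to a vertex `u`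
non-adjacent to both ends of an edge `vw`. -/
noncomputable def pglRep (huv : ¬Γ.Adj u v) (huw : ¬Γ.Adj u w) :
    RACG Γ →* ProjGenLinGroup (Fin 2) ℤ :=
  lift (fun x => if x = u then ProjGenLinGroup.mk shearReflection
      else if x = v then ProjGenLinGroup.mk diagReflection
      else if x = w then ProjGenLinGroup.mk swapReflection else 1)
    (fun x => by
      split_ifs
      · exact reflection_mul_self _ _ _ _
      · exact reflection_mul_self _ _ _ _
      · exact reflection_mul_self _ _ _ _
      · exact one_mul 1)
    (fun x y hxy => by
      have := commute_diagReflection_swapReflection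
      split_ifs
      all_goals first
        | exact Commute.one_left _
        | exact Commute.one_right _
        | exact Commute.refl _
        | exact this
        | exact this.symm
        | (subst_vars; exact absurd hxy ‹_›)
        | (subst_vars; exact absurd hxy.symm ‹_›))

section pglRep

variable (huv : ¬Γ.Adj u v) (huw : ¬Γ.Adj u w)

lemma pglRep_left : pglRep huv huw (of Γ u) = ProjGenLinGroup.mk shearReflection := by
  rw [pglRep, lift_of, if_pos rfl]

lemma pglRep_middle (hne : v ≠ u) :
    pglRep huv huw (of Γ v) = ProjGenLinGroup.mk diagReflection := by
  rw [pglRep, lift_of, if_neg hne, if_pos rfl]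

lemma pglRep_right (hne : w ≠ u) (hne' : w ≠ v) :
    pglRep huv huw (of Γ w) = ProjGenLinGroup.mk swapReflection := by
  rw [pglRep, lift_of, if_neg hne, if_neg hne', if_pos rfl]

lemma pglRep_of_ne {x : V} (hu : x ≠ u) (hv : x ≠ v) (hw : x ≠ w) :
    pglRep huv huw (of Γ x) = 1 := by
  rw [pglRep, lift_of, if_neg hu, if_neg hv, if_neg hw]

end pglRep

open Classical in
/-- The sign character sending the generators in `S` to `-1` and the others to `1`. -/
noncomputable def signCharacter (Γ : SimpleGraph V) (S : Set V) : RACG Γ →* ℤˣ :=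
  lift (fun x => if x ∈ S then -1 else 1) (fun _ => Int.units_mul_self _)
    (fun _ _ _ => Commute.all _ _)

lemma signCharacter_of_mem {S : Set V} {x : V} (h : x ∈ S) : signCharacter Γ S (of Γ x) = -1 := by
  rw [signCharacter, lift_of, if_pos h]

lemma signCharacter_of_notMem {S : Set V} {x : V} (h : x ∉ S) :
    signCharacter Γ S (of Γ x) = 1 := by
  rw [signCharacter, lift_of, if_neg h]

lemma exists_rep_pglRep (huv : ¬Γ.Adj u v) (huw : ¬Γ.Adj u w) (hvu : v ≠ u) (hwu : w ≠ u)
    (hwv : w ≠ v) (y : RACG Γ) : ∃ A : GL (Fin 2) ℤ, pglRep huv huw y = ProjGenLinGroup.mk A ∧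
      A 0 0 * A 1 1 - A 0 1 * A 1 0 = signCharacter Γ {u, v, w} y ∧
      (signCharacter Γ {w} y = 1 ∧ A 0 0 % 2 = 1 ∧ A 0 1 % 2 = 0 ∧ A 1 0 % 2 = 0 ∧ A 1 1 % 2 = 1 ∨
      signCharacter Γ {w} y = -1 ∧ A 0 0 % 2 = 0 ∧ A 0 1 % 2 = 1 ∧ A 1 0 % 2 = 1 ∧
        A 1 1 % 2 = 0) := by
  induction y using induction_left with
  | one => exact ⟨1, by simp⟩
  | mul x y ih =>
    obtain ⟨A, hA, hdet, hpar⟩ := ih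
    by_cases hxu : x = u
    · subst hxu
      refine ⟨shearReflection * A, by rw [map_mul, map_mul, hA, pglRep_left], ?_⟩
      simp only [map_mul, signCharacter_of_mem (show x ∈ ({x, v, w} : Set V) by simp),
        signCharacter_of_notMem (show x ∉ ({w} : Set V) by simpa using hwu.symm),
        GL_mul_apply_fin_two, shearReflection, coe_reflection, Matrix.of_apply,
        Matrix.cons_val', Matrix.cons_val_zero, Matrix.cons_val_one, Matrix.cons_val_fin_one,
        one_mul]
      push_cast
      rw [← hdet]
      refine ⟨by ring, ?_⟩
      refine hpar.imp ?_ ?_ <;> rintro ⟨h, h1, h2, h3, h4⟩ <;> refine ⟨h, ?_⟩ <;> omega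
    by_cases hxv : x = v
    · subst hxv
      refine ⟨diagReflection * A, by rw [map_mul, map_mul, hA, pglRep_middle _ _ hxu], ?_⟩
      simp only [map_mul, signCharacter_of_mem (show x ∈ ({u, x, w} : Set V) by simp),
        signCharacter_of_notMem (show x ∉ ({w} : Set V) by simpa using hwv.symm),
        GL_mul_apply_fin_two, diagReflection, coe_reflection, Matrix.of_apply,
        Matrix.cons_val', Matrix.cons_val_zero, Matrix.cons_val_one, Matrix.cons_val_fin_one,
        one_mul]
      push_cast
      rw [← hdet]
      refine ⟨by ring, ?_⟩
      refine hpar.imp ?_ ?_ <;> rintro ⟨h, h1, h2, h3, h4⟩ <;> refine ⟨h, ?_⟩ <;> omega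
    by_cases hxw : x = w
    · subst hxw
      refine ⟨swapReflection * A, by rw [map_mul, map_mul, hA, pglRep_right _ _ hxu hxv], ?_⟩
      simp only [map_mul, signCharacter_of_mem (show x ∈ ({u, v, x} : Set V) by simp),
        signCharacter_of_mem (show x ∈ ({x} : Set V) by simp),
        GL_mul_apply_fin_two, swapReflection, coe_reflection, Matrix.of_apply,
        Matrix.cons_val', Matrix.cons_val_zero, Matrix.cons_val_one, Matrix.cons_val_fin_one]
      push_cast
      rw [← hdet]
      refine ⟨by ring, ?_⟩
      refine (hpar.imp ?_ ?_).symm <;> rintro ⟨h, h1, h2, h3, h4⟩ <;>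
        refine ⟨by rw [h]; rfl, ?_⟩ <;> omega
    · refine ⟨A, by rw [map_mul, hA, pglRep_of_ne _ _ hxu hxv hxw, one_mul], ?_⟩
      rw [map_mul, map_mul, signCharacter_of_notMem (by simp [hxu, hxv, hxw]),
        signCharacter_of_notMem (by simpa using hxw), one_mul, one_mul]
      exact ⟨hdet, hpar⟩

lemma exists_oddForm_of_hom {d f a : ℤ} (h : a ^ 2 + (f + d) * (f - d) = 1)
    (ρ : RACG Γ →* ProjGenLinGroup (Fin 2) ℤ)
    (hu : ρ (of Γ u) = ProjGenLinGroup.mk (reflection a (f + d) (f - d) h))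
    (hv : ρ (of Γ v) = ProjGenLinGroup.mk diagReflection)
    (hw : ρ (of Γ w) = ProjGenLinGroup.mk swapReflection)
    (hne : ∀ x, x ≠ u → x ≠ v → x ≠ w → ρ (of Γ x) = 1) (y : RACG Γ) :
    ∃ A : GL (Fin 2) ℤ, ρ y = ProjGenLinGroup.mk A ∧
      (signCharacter Γ {u, v, w} y = 1 ∧ IsEvenForm d A ∨
        signCharacter Γ {u, v, w} y = -1 ∧ IsOddForm d A) := by
  induction y using induction_left with
  | one => exact ⟨1, by simp [isEvenForm_one]⟩
  | mul x y ih =>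
    obtain ⟨A, hA, hA'⟩ := ih
    have step : ∀ B : GL (Fin 2) ℤ, ρ (of Γ x) = ProjGenLinGroup.mk B → IsOddForm d B →
        x ∈ ({u, v, w} : Set V) → ∃ A : GL (Fin 2) ℤ, ρ (of Γ x * y) = ProjGenLinGroup.mk A ∧
      (signCharacter Γ {u, v, w} (of Γ x * y) = 1 ∧ IsEvenForm d A ∨
        signCharacter Γ {u, v, w} (of Γ x * y) = -1 ∧ IsOddForm d A) := by
      intro B hB hB' hx
      refine ⟨B * A, by rw [map_mul, map_mul, hB, hA], ?_⟩
      rw [map_mul, signCharacter_of_mem hx]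
      rcases hA' with ⟨h, hA'⟩ | ⟨h, hA'⟩
      · exact Or.inr ⟨by rw [h]; rfl, hB'.mul_isEvenForm hA'⟩
      · exact Or.inl ⟨by rw [h]; rfl, hB'.mul_isOddForm hA'⟩
    by_cases hxu : x = u
    · exact step _ (hxu ▸ hu) (isOddForm_reflection h) (by simp [hxu])
    by_cases hxv : x = v
    · exact step _ (hxv ▸ hv) (isOddForm_diagReflection d) (by simp [hxv])
    by_cases hxw : x = w
    · exact step _ (hxw ▸ hw) (isOddForm_swapReflection d) (by simp [hxw])
    · refine ⟨A, by rw [map_mul, hA, hne x hxu hxv hxw, one_mul], ?_⟩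
      rwa [map_mul, signCharacter_of_notMem (by simp [hxu, hxv, hxw]), one_mul]

lemma exists_conj_pglRep (huv : ¬Γ.Adj u v) (huw : ¬Γ.Adj u w) (hvw : Γ.Adj v w) (hvu : v ≠ u)
    (hwu : w ≠ u) {φ : MulAut (RACG Γ)} (hφ : φ ∈ signStabilizer (RACG Γ)) :
    ∃ g, ∀ y, pglRep huv huw (φ y) = g * pglRep huv huw y * g⁻¹ := by
  have hwv := hvw.ne'
  have hsq : ∀ x, pglRep huv huw (φ (of Γ x)) * pglRep huv huw (φ (of Γ x)) = 1 := fun x => by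
    rw [← map_mul, ← map_mul, of_mul_self, map_one, map_one]
  have hex := fun x => exists_rep_pglRep huv huw hvu hwu hwv (φ (of Γ x))
  simp only [mem_signStabilizer.1 hφ] at hex
  have hother : ∀ x, x ≠ u → x ≠ v → x ≠ w → pglRep huv huw (φ (of Γ x)) = 1 := by
    intro x hu hv hw
    obtain ⟨A, hA, hdet, hpar⟩ := hex x
    have hs := hsq x
    rw [signCharacter_of_notMem (by simp [hu, hv, hw])] at hdet
    rw [signCharacter_of_notMem (by simpa using hw)] at hpar
    obtain ⟨-, h00, h01, h10, -⟩ := hpar.resolve_right (by simp)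
    rw [hA] at hs ⊢
    exact pgl_mk_eq_one_of_det_eq_one hdet h00 h01 h10 hs
  have hrefl : ∀ x ∈ ({u, v, w} : Set V), ∃ (a b c : ℤ) (h : a ^ 2 + b * c = 1),
      pglRep huv huw (φ (of Γ x)) = ProjGenLinGroup.mk (reflection a b c h) ∧
      (x ≠ w → a % 2 = 1 ∧ b % 2 = 0 ∧ c % 2 = 0) ∧ (x = w → b % 2 = 1) := by
    intro x hx
    obtain ⟨A, hA, hdet, hpar⟩ := hex x
    have hs := hsq x
    rw [signCharacter_of_mem hx] at hdet
    rw [hA] at hs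
    obtain ⟨h, hA'⟩ := exists_eq_reflection hdet hs
    refine ⟨_, _, _, h, by rw [← hA', hA], fun hxw => ?_, fun hxw => ?_⟩
    · rw [signCharacter_of_notMem (by simpa using hxw)] at hpar
      obtain ⟨-, h00, h01, h10, -⟩ := hpar.resolve_right (by simp)
      exact ⟨h00, h01, h10⟩
    · rw [signCharacter_of_mem (by simpa using hxw)] at hpar
      exact (hpar.resolve_left (by simp)).2.2.1
  obtain ⟨a, b, c, h, hV, hVp, -⟩ := hrefl v (by simp)
  obtain ⟨x, y, z, h', hW, -, hWp⟩ := hrefl w (by simp)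
  obtain ⟨k, l, m, h'', hU, hUp, -⟩ := hrefl u (by simp)
  obtain ⟨ha, hb, hc⟩ := hVp hvw.ne
  obtain ⟨-, hl, hm⟩ := hUp hwu.symm
  have hcomm := (commute_of_adj hvw).map ((pglRep huv huw).comp φ.toMonoidHom)
  simp only [MonoidHom.comp_apply, MulEquiv.toMonoidHom_eq_coe, MonoidHom.coe_coe] at hcomm
  rw [hV, hW] at hcomm
  have htr := trace_mul_eq_zero_of_commute ha hb (hWp rfl) hcomm
  obtain ⟨g, hg1, hg2⟩ := exists_conj_diagReflection_swapReflection (h := h) (h' := h')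
    ha hb hc htr
  obtain ⟨d, f, k, h3, hfd, hg3⟩ := exists_conj_reflection g h'' hl hm
  rw [← hV] at hg1
  rw [← hW] at hg2
  rw [← hU] at hg3
  set G := ProjGenLinGroup.mk g with hG
  let ρ : RACG Γ →* ProjGenLinGroup (Fin 2) ℤ :=
    ((MulAut.conj G⁻¹).toMonoidHom.comp (pglRep huv huw)).comp φ.toMonoidHom
  have hρ : ∀ y, ρ y = G⁻¹ * pglRep huv huw (φ y) * G := fun y => by simp [ρ]
  have hd := isUnit_of_forall_exists_isOddForm (d := d) g (by
    have key : ∀ (x : V) (B : GL (Fin 2) ℤ), x ∈ ({u, v, w} : Set V) →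
        pglRep huv huw (of Γ x) = ProjGenLinGroup.mk B →
        ∃ A, IsOddForm d A ∧ G * ProjGenLinGroup.mk A = ProjGenLinGroup.mk B * G := by
      intro x B hx hB
      obtain ⟨A, hA, hpar⟩ := exists_oddForm_of_hom h3 ρ
        (by rw [hρ, mul_assoc, hg3, inv_mul_cancel_left])
        (by rw [hρ, mul_assoc, hg1, inv_mul_cancel_left])
        (by rw [hρ, mul_assoc, hg2, inv_mul_cancel_left])
        (fun x hu hv hw => by rw [hρ, hother x hu hv hw, mul_one, inv_mul_cancel])
        (φ⁻¹ (of Γ x))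
      rw [← mem_signStabilizer.1 hφ, MulAut.apply_inv_self, signCharacter_of_mem hx] at hpar
      refine ⟨A, (hpar.resolve_left (by simp)).2, ?_⟩
      rw [← hA, hρ, MulAut.apply_inv_self, hB, mul_assoc, mul_inv_cancel_left]
    rintro B (rfl | rfl | rfl)
    · exact key v _ (by simp) (pglRep_middle huv huw hvu)
    · exact key w _ (by simp) (pglRep_right huv huw hwu hwv)
    · exact key u _ (by simp) (pglRep_left huv huw))
  obtain ⟨t, ht, htv, htw⟩ := exists_conj_shearReflection h3 hfd hd
  refine ⟨G * ProjGenLinGroup.mk t, fun y => ?_⟩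
  have : (pglRep huv huw).comp φ.toMonoidHom =
      (MulAut.conj (G * ProjGenLinGroup.mk t)).toMonoidHom.comp (pglRep huv huw) := by
    refine hom_ext fun x => ?_
    simp only [MonoidHom.comp_apply, MulEquiv.toMonoidHom_eq_coe, MonoidHom.coe_coe,
      MulAut.conj_apply]
    rw [eq_mul_inv_iff_mul_eq, ← mul_assoc]
    by_cases hxu : x = u
    · rw [hxu, pglRep_left, hg3, mul_assoc, ht, mul_assoc]
    by_cases hxv : x = v
    · rw [hxv, pglRep_middle _ _ hvu, hg1, mul_assoc, htv.eq, mul_assoc]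
    by_cases hxw : x = w
    · rw [hxw, pglRep_right _ _ hwu hwv, hg2, mul_assoc, htw.eq, mul_assoc]
    · rw [hother x hxu hxv hxw, pglRep_of_ne _ _ hxu hxv hxw, one_mul, mul_one]
  exact DFunLike.congr_fun this y

end RACG

theorem sqUniversal_of_adj {V : Type*} [Finite V] {Γ : SimpleGraph V} {u v w : V}
    (huv : ¬Γ.Adj u v) (huw : ¬Γ.Adj u w) (hvw : Γ.Adj v w) (hvu : v ≠ u) (hwu : w ≠ u) :
    SQUniversal (MulAut (RACG Γ)) := by
  have hwv := hvw.ne'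
  have hcent : ∀ p, (∀ y, Commute p (RACG.pglRep huv huw y)) → p = 1 := fun p hp =>
    eq_one_of_commute_reflections (RACG.pglRep_middle huv huw hvu ▸ hp (RACG.of Γ v))
      (RACG.pglRep_left huv huw ▸ hp (RACG.of Γ u))
  obtain ⟨θ, hθ⟩ := exists_conjugator_hom (RACG.pglRep huv huw) hcent (signStabilizer (RACG Γ))
    fun φ hφ => RACG.exists_conj_pglRep huv huw hvw hvu hwu hφ
  have hrange : ∀ y, RACG.pglRep huv huw y ∈ θ.range := fun y => by
    refine ⟨⟨MulAut.conj y, conj_mem_signStabilizer y⟩, ?_⟩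
    refine eq_of_conj_eq_conj hcent fun z => ?_
    rw [← hθ, ← map_mul, ← map_inv, ← map_mul]
    rfl
  refine sqUniversal_of_hom_pgl θ ?_ ?_
  · have : ProjGenLinGroup.mk upperTwo = RACG.pglRep huv huw (RACG.of Γ u * RACG.of Γ v) := by
      rw [map_mul, RACG.pglRep_left, RACG.pglRep_middle _ _ hvu, ← map_mul]
      congr 1
      apply GL_ext_fin_two <;> rw [GL_mul_apply_fin_two] <;>
        simp [upperTwo, shearReflection, diagReflection]
    rw [this]
    exact hrange _
  · have : ProjGenLinGroup.mk lowerTwo = RACG.pglRep huv huw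
        (RACG.of Γ w * RACG.of Γ u * RACG.of Γ v * RACG.of Γ w) := by
      rw [map_mul, map_mul, map_mul, RACG.pglRep_left, RACG.pglRep_middle _ _ hvu,
        RACG.pglRep_right _ _ hwu hwv, ← map_mul, ← map_mul, ← map_mul]
      congr 1
      apply GL_ext_fin_two <;> simp only [GL_mul_apply_fin_two] <;>
        simp [lowerTwo, shearReflection, diagReflection, swapReflection]
    rw [this]
    exact hrange _

/-- The coclique formed by three pairwise non-adjacent vertices. -/
def PointedCoclique.ofTriple {V : Type*} {Γ : SimpleGraph V} {u v w : V} (hvw : v ≠ w)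
    (hvu : v ≠ u) (hwu : w ≠ u) (huv : ¬Γ.Adj u v) (huw : ¬Γ.Adj u w) (hvw' : ¬Γ.Adj v w) :
    PointedCoclique Γ (Fin 2) where
  vertex o := o.elim u ![v, w]
  injective := by
    intro o o' h
    rcases o with _ | i <;> rcases o' with _ | j <;> [skip; fin_cases j; fin_cases i;
      (fin_cases i <;> fin_cases j)] <;> simp_all [eq_comm]
  not_adj := by
    intro o o' h
    rcases o with _ | i <;> rcases o' with _ | j <;> [skip; fin_cases j; fin_cases i;
      (fin_cases i <;> fin_cases j)] <;> simp_all [Γ.adj_comm]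

theorem sqUniversal_of_hasVertex {V : Type*} [Finite V] {Γ : SimpleGraph V}
    (hΓ : HasVertexWithTwoNonNeighbors Γ) : SQUniversal (MulAut (RACG Γ)) := by
  obtain ⟨u, v, w, hvw, hvu, hwu, huv, huw⟩ := hΓ
  by_cases h : ∃ a b c, b ≠ a ∧ c ≠ a ∧ ¬Γ.Adj a b ∧ ¬Γ.Adj a c ∧ Γ.Adj b c
  · obtain ⟨a, b, c, hba, hca, hab, hac, hbc⟩ := h
    exact sqUniversal_of_adj hab hac hbc hba hca
  · have hvw' : ¬Γ.Adj v w := fun hadj => h ⟨u, v, w, hvu, hwu, huv, huw, hadj⟩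
    let C := PointedCoclique.ofTriple hvw hvu hwu huv huw hvw'
    refine sqUniversal_of_coclique C fun o o' x hx => ?_
    by_contra hx'
    refine h ⟨C.vertex o', C.vertex o, x, ?_, ?_, C.not_adj _ _, hx', hx⟩
    · intro he
      exact hx' (he ▸ hx)
    · rintro rfl
      exact C.not_adj _ _ hx

end

/-- `Aut(C_Γ)` is SQ-universal iff some vertex of `Γ` is non-adjacent to at least two other
vertices. -/
theorem racg_aut_sqUniversal_iff {V : Type} [Fintype V] (Γ : SimpleGraph V) :
    SQUniversal (MulAut (RACG Γ)) ↔ HasVertexWithTwoNonNeighbors Γ := by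
  exact ⟨fun h => by_contra fun hΓ => not_sqUniversal_of_not_hasVertex hΓ h,
    sqUniversal_of_hasVertex⟩
end
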